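/- arXiv:2310.05903 — 2 statements merged into one kernel-verified Lean document; each statement's English description precedes it below -/
import Mathlib

section
/- Every even-hole-free graph with no sector wheel admits a chordal cover, i.e., there exist vertex subsets X1, X2 with X1 ∪ X2 = V(G) such that the induced subgraphs G[X1] and G[X2] are both chordal. -/
open Classical

universe u

/-- `IsHoleOn G n H`: `H` is the vertex set of an induced cycle of `G` of length `n ≥ 4`. -/
def IsHoleOn {V : Type u} (G : SimpleGraph V) (n : ℕ) (H : Set V) : Prop :=
  4 ≤ n ∧ ∃ f : ZMod n → V, Function.Injective f ∧ Set.range f = H ∧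
    ∀ i j : ZMod n, G.Adj (f i) (f j) ↔ (j = i + 1 ∨ i = j + 1)

/-- A hole: an induced cycle of length at least 4. -/
def IsHole {V : Type u} (G : SimpleGraph V) (H : Set V) : Prop :=
  ∃ n : ℕ, IsHoleOn G n H

/-- No induced cycle of even length. -/
def EvenHoleFree {V : Type u} (G : SimpleGraph V) : Prop :=
  ∀ (n : ℕ) (H : Set V), IsHoleOn G n H → ¬ Even n

/-- `G[X]` is chordal: no hole of `G` is contained in `X`. -/
def ChordalSet {V : Type u} (G : SimpleGraph V) (X : Set V) : Prop :=
  ∀ H : Set V, H ⊆ X → ¬ IsHole G H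

/-- A wheel `(H, w)`: a hole `H` and `w ∉ H` with at least 3 neighbors in `H`. -/
def IsWheel {V : Type u} (G : SimpleGraph V) (H : Set V) (w : V) : Prop :=
  IsHole G H ∧ w ∉ H ∧ 3 ≤ (H ∩ {u | G.Adj w u}).ncard

/-- An induced path of `G`, recorded as the list of its vertices in order. -/
def IsInducedPathList {V : Type u} (G : SimpleGraph V) (l : List V) : Prop :=
  l ≠ [] ∧ l.Nodup ∧
    ∀ (i j : ℕ) (hi : i < l.length) (hj : j < l.length),
      G.Adj (l.get ⟨i, hi⟩) (l.get ⟨j, hj⟩) ↔ (i + 1 = j ∨ j + 1 = i)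

/-- A vertex set that induces a path. -/
def InducesPath {V : Type u} (G : SimpleGraph V) (S : Set V) : Prop :=
  ∃ l : List V, IsInducedPathList G l ∧ {v | v ∈ l} = S

/-- A sector wheel: a wheel `(H, w)` where `w` is complete to `H` or
`N(w) ∩ H` induces a path. -/
def IsSectorWheel {V : Type u} (G : SimpleGraph V) (H : Set V) (w : V) : Prop :=
  IsWheel G H w ∧
    ((∀ u ∈ H, G.Adj w u) ∨ InducesPath G (H ∩ {u | G.Adj w u}))

/-- A twin wheel: a wheel `(H, w)` where `N(w) ∩ H` induces a three-vertex path. -/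
def IsTwinWheel {V : Type u} (G : SimpleGraph V) (H : Set V) (w : V) : Prop :=
  IsWheel G H w ∧ ∃ a b c : V, a ≠ b ∧ b ≠ c ∧ a ≠ c ∧
    H ∩ {u | G.Adj w u} = {a, b, c} ∧ G.Adj a b ∧ G.Adj b c ∧ ¬ G.Adj a c

/-- A short pyramid: a wheel `(H, w)` where `N(w) ∩ H` is an edge plus an isolated vertex. -/
def IsShortPyramid {V : Type u} (G : SimpleGraph V) (H : Set V) (w : V) : Prop :=
  IsWheel G H w ∧ ∃ a b c : V, a ≠ b ∧ b ≠ c ∧ a ≠ c ∧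
    H ∩ {u | G.Adj w u} = {a, b, c} ∧ G.Adj a b ∧ ¬ G.Adj a c ∧ ¬ G.Adj b c

/-- A flat path: an induced path all of whose interior vertices have degree 2 in `G`. -/
def IsFlatPath {V : Type u} (G : SimpleGraph V) (l : List V) : Prop :=
  IsInducedPathList G l ∧
    ∀ (i : ℕ) (hi : i < l.length), 0 < i → i + 1 < l.length →
      ({u | G.Adj (l.get ⟨i, hi⟩) u}).ncard = 2

/-- The closed neighborhood `N[S]` of a set of vertices. -/
def ClosedNbhd {V : Type u} (G : SimpleGraph V) (S : Set V) : Set V :=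
  S ∪ {v | ∃ s ∈ S, G.Adj v s}

/-- `(W1, W2)` (a precover on a path with vertex set `S`) extends to a chordal cover of `G`. -/
def ExtendsToCover {V : Type u} (G : SimpleGraph V) (S W1 W2 : Set V) : Prop :=
  ∃ X1 X2 : Set V, W1 ⊆ X1 ∧ W2 ⊆ X2 ∧ ChordalSet G X1 ∧ ChordalSet G X2 ∧
    X1 ∩ X2 = S ∧ X1 ∪ X2 = Set.univ

/-- Flat path extendable. -/
def FPE {V : Type u} (G : SimpleGraph V) : Prop :=
  ∀ l : List V, IsFlatPath G l →
    ∀ W1 W2 : Set V, ChordalSet G W1 → ChordalSet G W2 →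
      W1 ∩ W2 = {v | v ∈ l} → W1 ∪ W2 = ClosedNbhd G {v | v ∈ l} →
      ExtendsToCover G {v | v ∈ l} W1 W2

/-- Weakly flat path extendable: only paths with at most two vertices are considered. -/
def WeaklyFPE {V : Type u} (G : SimpleGraph V) : Prop :=
  ∀ l : List V, IsInducedPathList G l → l.length ≤ 2 →
    ∀ W1 W2 : Set V, ChordalSet G W1 → ChordalSet G W2 →
      W1 ∩ W2 = {v | v ∈ l} → W1 ∪ W2 = ClosedNbhd G {v | v ∈ l} →
      ExtendsToCover G {v | v ∈ l} W1 W2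

/-- Minimal non flat path extendable. -/
def MNFPE {V : Type u} (G : SimpleGraph V) : Prop :=
  ¬ FPE G ∧ ∀ S : Set V, S ≠ Set.univ → FPE (G.induce S)

/-- Minimal non-weakly flat path extendable. -/
def MinNonWeaklyFPE {V : Type u} (G : SimpleGraph V) : Prop :=
  ¬ WeaklyFPE G ∧ ∀ S : Set V, S ≠ Set.univ → WeaklyFPE (G.induce S)

/-- A witness path `l` with witness sets `W1, W2`: a precover on a flat path
admitting no extension to a chordal cover. -/
def WitnessPath {V : Type u} (G : SimpleGraph V) (l : List V) (W1 W2 : Set V) : Prop :=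
  IsFlatPath G l ∧ ChordalSet G W1 ∧ ChordalSet G W2 ∧
    W1 ∩ W2 = {v | v ∈ l} ∧ W1 ∪ W2 = ClosedNbhd G {v | v ∈ l} ∧
    ¬ ExtendsToCover G {v | v ∈ l} W1 W2

/-- A witness path of length zero or one with witness sets, for the weak notion. -/
def WeakWitness {V : Type u} (G : SimpleGraph V) (l : List V) (W1 W2 : Set V) : Prop :=
  IsInducedPathList G l ∧ l.length ≤ 2 ∧ ChordalSet G W1 ∧ ChordalSet G W2 ∧
    W1 ∩ W2 = {v | v ∈ l} ∧ W1 ∪ W2 = ClosedNbhd G {v | v ∈ l} ∧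
    ¬ ExtendsToCover G {v | v ∈ l} W1 W2

/-- `N(v)` is the union of a clique and a singleton. -/
def NearlySimplicial {V : Type u} (G : SimpleGraph V) (v : V) : Prop :=
  ∃ (K : Set V) (u : V), G.IsClique K ∧ {w | G.Adj v w} = K ∪ {u}

/-- `G` has a star cutset. -/
def HasStarCutset {V : Type u} (G : SimpleGraph V) : Prop :=
  G.Connected ∧ ∃ (v : V) (C : Set V), v ∈ C ∧ C ⊆ insert v {u | G.Adj v u} ∧
    ¬ (G.induce (Cᶜ : Set V)).Connected

/-- `v` is the center of a star cutset of `G`. -/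
def IsStarCutsetCenter {V : Type u} (G : SimpleGraph V) (v : V) : Prop :=
  G.Connected ∧ ∃ C : Set V, v ∈ C ∧ C ⊆ insert v {u | G.Adj v u} ∧
    ¬ (G.induce (Cᶜ : Set V)).Connected

/-- `G` has a full star cutset, i.e. a star cutset of the form `N[v]`. -/
def HasFullStarCutset {V : Type u} (G : SimpleGraph V) : Prop :=
  G.Connected ∧ ∃ v : V,
    ¬ (G.induce (((insert v {u | G.Adj v u}) : Set V)ᶜ)).Connected

/-- A clique cutset. -/
def IsCliqueCutset {V : Type u} (G : SimpleGraph V) (Q : Set V) : Prop :=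
  G.IsClique Q ∧ ¬ (G.induce (Qᶜ : Set V)).Connected

/-- `C` is (the vertex set of) a connected component of `G[S]`. -/
def IsCompOf {V : Type u} (G : SimpleGraph V) (S C : Set V) : Prop :=
  ∃ comp : (G.induce S).ConnectedComponent, C = Subtype.val '' comp.supp

/-- A marker path for the side `(A, C, B)` of a 2-join, with ends `a ∈ A` and `b ∈ B`
and interior in `C`. -/
def IsMarkerPath {V : Type u} (G : SimpleGraph V) (A C B : Set V) (a b : V)
    (l : List V) : Prop :=
  IsInducedPathList G l ∧ a ∈ A ∧ b ∈ B ∧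
    ∃ m : List V, l = a :: (m ++ [b]) ∧ ∀ v ∈ m, v ∈ C

/-- A 2-join of `G`. -/
def IsTwoJoin {V : Type u} (G : SimpleGraph V) (A1 C1 B1 A2 C2 B2 : Set V) : Prop :=
  ([A1, C1, B1, A2, C2, B2] : List (Set V)).Pairwise Disjoint ∧
  A1 ∪ C1 ∪ B1 ∪ A2 ∪ C2 ∪ B2 = Set.univ ∧
  (∀ a ∈ A1, ∀ b ∈ A2, G.Adj a b) ∧
  (∀ a ∈ B1, ∀ b ∈ B2, G.Adj a b) ∧
  (∀ u ∈ A1 ∪ C1 ∪ B1, ∀ v ∈ A2 ∪ C2 ∪ B2, G.Adj u v →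
    ((u ∈ A1 ∧ v ∈ A2) ∨ (u ∈ B1 ∧ v ∈ B2))) ∧
  (∃ (a b : V) (l : List V), IsMarkerPath G A1 C1 B1 a b l ∧
      A1 ∪ C1 ∪ B1 ≠ {v | v ∈ l}) ∧
  (∃ (a b : V) (l : List V), IsMarkerPath G A2 C2 B2 a b l ∧
      A2 ∪ C2 ∪ B2 ≠ {v | v ∈ l})

/-- A leaf of a graph: a vertex of degree one. -/
def IsLeaf {V : Type u} (T : SimpleGraph V) (v : V) : Prop :=
  ({u | T.Adj v u}).ncard = 1

/-- The graph `B(T)` built from a tree `T` whose bipartition is given by the proper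
2-coloring `c`: vertices are the edges of `T` plus two extra vertices `x_false, x_true`
(encoded as `Bool`); two edges are adjacent iff they share an endpoint, `x_i` is adjacent
to the pendant edge at each leaf on side `i`, and `x_false` is adjacent to `x_true`. -/
def BGraph {V : Type u} (T : SimpleGraph V) (c : V → Bool) :
    SimpleGraph (↥T.edgeSet ⊕ Bool) :=
  SimpleGraph.fromRel fun a b =>
    match a, b with
    | Sum.inl e, Sum.inl f => ∃ v : V, v ∈ e.val ∧ v ∈ f.val
    | Sum.inl e, Sum.inr i => ∃ v : V, IsLeaf T v ∧ c v = i ∧ v ∈ e.val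
    | Sum.inr _, Sum.inl _ => False
    | Sum.inr _, Sum.inr _ => True

/-- An induced path, as a possibly empty list of vertices. -/
def IsIndPath {V : Type u} (G : SimpleGraph V) (l : List V) : Prop :=
  ∀ (i j : ℕ) (hj : j < l.length) (hij : i < j),
    l[i] ≠ l[j] ∧ (G.Adj l[i] l[j] ↔ j = i + 1)

section IndPath

variable {V : Type u} {G : SimpleGraph V}

lemma IsIndPath.nodup {l : List V} (h : IsIndPath G l) : l.Nodup := by
  rw [List.nodup_iff_injective_getElem]
  intro i j hij
  rcases lt_trichotomy i.1 j.1 with hlt | heq | hlt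
  · exact absurd hij (h i.1 j.1 j.2 hlt).1
  · exact Fin.ext heq
  · exact absurd hij.symm (h j.1 i.1 i.2 hlt).1

lemma List.Nodup.getLast?_eq_some_getElem_iff {l : List V} (h : l.Nodup) {i : ℕ}
    (hi : i < l.length) : l.getLast? = some l[i] ↔ i + 1 = l.length := by
  rw [List.getLast?_eq_getElem?, List.getElem?_eq_getElem (by omega), Option.some_inj,
    h.getElem_inj_iff]
  omega

lemma List.Nodup.head?_eq_some_getElem_iff {l : List V} (h : l.Nodup) {i : ℕ}
    (hi : i < l.length) : l.head? = some l[i] ↔ i = 0 := by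
  rw [List.head?_eq_getElem?, List.getElem?_eq_getElem (by omega), Option.some_inj,
    h.getElem_inj_iff]
  omega

lemma isIndPath_singleton (x : V) : IsIndPath G [x] := by
  intro i j hj hij; simp at hj; omega

lemma IsIndPath.reverse {l : List V} (h : IsIndPath G l) : IsIndPath G l.reverse := by
  intro i j hj hij
  simp only [List.length_reverse] at hj
  have := h (l.length - 1 - j) (l.length - 1 - i) (by omega) (by omega)
  simp only [List.getElem_reverse]
  refine ⟨this.1.symm, ?_⟩
  rw [G.adj_comm, this.2]
  omega

lemma isIndPath_append {l m : List V} (hl : IsIndPath G l) (hm : IsIndPath G m)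
    (hne : ∀ x ∈ l, ∀ y ∈ m, x ≠ y)
    (hadj : ∀ x ∈ l, ∀ y ∈ m, G.Adj x y ↔ (l.getLast? = some x ∧ m.head? = some y)) :
    IsIndPath G (l ++ m) := by
  intro i j hj hij
  simp only [List.length_append] at hj
  by_cases h1 : j < l.length
  · rw [List.getElem_append_left h1, List.getElem_append_left (by omega)]
    exact hl i j h1 hij
  · by_cases h2 : i < l.length
    · rw [List.getElem_append_left h2, List.getElem_append_right (by omega)]
      refine ⟨hne _ (List.getElem_mem _) _ (List.getElem_mem _), ?_⟩
      rw [hadj _ (List.getElem_mem _) _ (List.getElem_mem _)]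
      rw [hl.nodup.getLast?_eq_some_getElem_iff h2, hm.nodup.head?_eq_some_getElem_iff (by omega)]
      omega
    · rw [List.getElem_append_right (by omega), List.getElem_append_right (by omega)]
      have := hm (i - l.length) (j - l.length) (by omega) (by omega)
      refine ⟨this.1, ?_⟩
      rw [this.2]
      omega

lemma isIndPath_cons {x : V} {l : List V} (hl : IsIndPath G l) (hx : x ∉ l)
    (hadj : ∀ y ∈ l, G.Adj x y ↔ l.head? = some y) : IsIndPath G (x :: l) := by
  apply isIndPath_append (l := [x]) (isIndPath_singleton x) hl
  · rintro a ha y hy rfl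
    simp at ha
    exact hx (ha ▸ hy)
  · intro a ha y hy
    simp at ha
    subst ha
    simp [hadj y hy]

lemma IsIndPath.of_append_left {l m : List V} (h : IsIndPath G (l ++ m)) : IsIndPath G l := by
  intro i j hj hij
  have := h i j (by simp; omega) hij
  rwa [List.getElem_append_left (by omega), List.getElem_append_left (by omega)] at this

lemma IsIndPath.of_append_right {l m : List V} (h : IsIndPath G (l ++ m)) : IsIndPath G m := by
  intro i j hj hij
  have := h (l.length + i) (l.length + j) (by simp; omega) (by omega)
  simp only [List.getElem_append_right (Nat.le_add_right _ _), Nat.add_sub_cancel_left] at this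
  refine ⟨this.1, ?_⟩
  rw [this.2]
  omega

lemma IsIndPath.append_adj {l m : List V} (h : IsIndPath G (l ++ m)) {x y : V}
    (hx : x ∈ l) (hy : y ∈ m) :
    x ≠ y ∧ (G.Adj x y ↔ (l.getLast? = some x ∧ m.head? = some y)) := by
  obtain ⟨i, hi, rfl⟩ := List.getElem_of_mem hx
  obtain ⟨j, hj, rfl⟩ := List.getElem_of_mem hy
  have := h i (l.length + j) (by simp; omega) (by omega)
  rw [List.getElem_append_left hi] at this
  simp only [List.getElem_append_right (Nat.le_add_right _ _), Nat.add_sub_cancel_left] at this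
  refine ⟨this.1, ?_⟩
  rw [this.2]
  rw [h.of_append_left.nodup.getLast?_eq_some_getElem_iff hi,
    h.of_append_right.nodup.head?_eq_some_getElem_iff hj]
  omega

lemma IsIndPath.isInducedPathList {l : List V} (h : IsIndPath G l) (hl : l ≠ []) :
    IsInducedPathList G l := by
  refine ⟨hl, h.nodup, ?_⟩
  intro i j hi hj
  simp only [List.get_eq_getElem]
  rcases lt_trichotomy i j with hlt | heq | hlt
  · rw [(h i j hj hlt).2]; omega
  · subst heq; simp
  · rw [G.adj_comm, (h j i hi hlt).2]; omega

/-- An induced path closed up by one more vertex gives a hole. -/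
lemma IsIndPath.isHoleOn_cons {x : V} {l : List V} (hl : IsIndPath G l) (hlen : 3 ≤ l.length)
    (hx : x ∉ l) (hadj : ∀ y ∈ l, G.Adj x y ↔ (l.head? = some y ∨ l.getLast? = some y)) :
    IsHoleOn G (l.length + 1) {v | v ∈ x :: l} := by
  set n := l.length + 1 with hn
  have hlen' : (x :: l).length = n := by simp [hn]
  have : NeZero n := ⟨by omega⟩
  have hnd : (x :: l).Nodup := List.nodup_cons.2 ⟨hx, hl.nodup⟩
  have key : ∀ i j : ℕ, i < j → ∀ hj : j < (x :: l).length, ∀ hi : i < (x :: l).length,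
      (G.Adj (x :: l)[i] (x :: l)[j] ↔ (j = i + 1 ∨ (i = 0 ∧ j = l.length))) := by
    intro i j hij hj hi
    obtain ⟨j, rfl⟩ : ∃ j', j = j' + 1 := ⟨j - 1, by omega⟩
    have hj' : j < l.length := by simpa using hj
    rcases i with _ | i
    · simp only [List.getElem_cons_zero, List.getElem_cons_succ]
      rw [hadj _ (List.getElem_mem _)]
      rw [hl.nodup.getLast?_eq_some_getElem_iff hj', hl.nodup.head?_eq_some_getElem_iff hj']
      simp
    · simp only [List.getElem_cons_succ]
      rw [(hl i j hj' (by omega)).2]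
      omega
  refine ⟨by omega, fun i => (x :: l)[i.val]'(by rw [hlen']; exact ZMod.val_lt i), ?_, ?_, ?_⟩
  · intro i j hij
    exact ZMod.val_injective n (hnd.getElem_inj_iff.1 hij)
  · ext v
    constructor
    · rintro ⟨i, rfl⟩
      exact List.getElem_mem _
    · intro hv
      obtain ⟨i, hi, rfl⟩ := List.getElem_of_mem (show v ∈ x :: l from hv)
      refine ⟨(i : ZMod n), ?_⟩
      have : ((i : ZMod n)).val = i := ZMod.val_natCast_of_lt (by omega)
      simp only [this]
  · have hone : (1 : ZMod n).val = 1 := by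
      have : Fact (1 < n) := ⟨by omega⟩
      exact ZMod.val_one n
    have succ_iff : ∀ i j : ZMod n, j = i + 1 ↔
        (j.val = i.val + 1 ∨ (j.val = 0 ∧ i.val + 1 = n)) := by
      intro i j
      rw [← (ZMod.val_injective n).eq_iff, ZMod.val_add, hone]
      have hi := ZMod.val_lt i
      have hj := ZMod.val_lt j
      rcases Nat.lt_or_ge (i.val + 1) n with h | h
      · rw [Nat.mod_eq_of_lt h]; omega
      · have : i.val + 1 = n := by omega
        rw [this, Nat.mod_self]; omega
    intro i j
    have hi := ZMod.val_lt i
    have hj := ZMod.val_lt j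
    rw [succ_iff, succ_iff]
    rcases lt_trichotomy i.val j.val with hlt | heq | hlt
    · rw [key _ _ hlt]; omega
    · simp only [heq, SimpleGraph.irrefl, false_iff]; omega
    · rw [G.adj_comm, key _ _ hlt]; omega

lemma not_isSectorWheel_path {H : Set V} {w : V} (hSW : ¬ IsSectorWheel G H w)
    (hH : IsHole G H) (hw : w ∉ H) {m : List V} (hm : IsIndPath G m) (hlen : 3 ≤ m.length)
    (hmem : ∀ y, y ∈ m ↔ y ∈ H ∧ G.Adj w y) : False := by
  have hset : {v | v ∈ m} = H ∩ {u | G.Adj w u} := by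
    ext y; simp [hmem]
  refine hSW ⟨⟨hH, hw, ?_⟩, Or.inr ⟨m, hm.isInducedPathList ?_, hset⟩⟩
  · rw [← hset]
    have : {v | v ∈ m} = (m.toFinset : Set V) := by ext; simp
    rw [this, Set.ncard_coe_finset, List.toFinset_card_of_nodup hm.nodup]
    exact hlen
  · rintro rfl; simp at hlen

lemma not_isSectorWheel_complete {l : List V} {w : V}
    (hSW : ¬ IsSectorWheel G {v | v ∈ l} w) (hl : l.Nodup) (hlen : 3 ≤ l.length)
    (hH : IsHole G {v | v ∈ l}) (hw : ∀ y ∈ l, G.Adj w y) : False := by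
  refine hSW ⟨⟨hH, fun h => G.irrefl (hw w h), ?_⟩, Or.inl hw⟩
  have hset : {v | v ∈ l} ∩ {u | G.Adj w u} = (l.toFinset : Set V) := by
    ext y; simp; exact fun h => hw y h
  rw [hset, Set.ncard_coe_finset, List.toFinset_card_of_nodup hl]
  exact hlen

/-- `p :: l` and `l ++ [q]` are induced paths, so `l` leads from `p` to `q`. -/
def IsLink (G : SimpleGraph V) (p q : V) (l : List V) : Prop :=
  l ≠ [] ∧ IsIndPath G (p :: l) ∧ IsIndPath G (l ++ [q])

lemma IsLink.symm {p q : V} {l : List V} (h : IsLink G p q l) : IsLink G q p l.reverse := by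
  refine ⟨by simpa using h.1, ?_, ?_⟩
  · simpa using h.2.2.reverse
  · simpa using h.2.1.reverse

lemma IsLink.isIndPath {p q : V} {l : List V} (h : IsLink G p q l) : IsIndPath G l :=
  h.2.2.of_append_left

lemma IsLink.left {p q x : V} {l : List V} (h : IsLink G p q l) (hx : x ∈ l) :
    p ≠ x ∧ (G.Adj p x ↔ l.head? = some x) := by
  simpa using IsIndPath.append_adj (l := [p]) (m := l) h.2.1 (x := p) (y := x) (by simp) hx

lemma IsLink.right {p q x : V} {l : List V} (h : IsLink G p q l) (hx : x ∈ l) :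
    q ≠ x ∧ (G.Adj q x ↔ l.getLast? = some x) := by
  have := h.2.2.append_adj (x := x) (y := q) hx (by simp)
  simpa [G.adj_comm, eq_comm] using this

lemma isLink_of {p q : V} {l : List V} (hne : l ≠ []) (hl : IsIndPath G l)
    (hp : ∀ x ∈ l, p ≠ x ∧ (G.Adj p x ↔ l.head? = some x))
    (hq : ∀ x ∈ l, q ≠ x ∧ (G.Adj q x ↔ l.getLast? = some x)) : IsLink G p q l := by
  refine ⟨hne, isIndPath_cons hl (fun h => (hp p h).1 rfl) fun y hy => (hp y hy).2, ?_⟩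
  apply isIndPath_append hl (isIndPath_singleton q)
  · rintro x hx y hy rfl
    simp at hy
    exact (hq x hx).1 hy.symm
  · intro x hx y hy
    simp at hy
    subst hy
    rw [G.adj_comm, (hq x hx).2]
    simp

lemma IsLink.isHoleOn_of_adj {p q : V} {l : List V} (h : IsLink G p q l) (hpq : G.Adj p q)
    (hlen : 2 ≤ l.length) : IsHoleOn G (l.length + 2) {v | v ∈ p :: (l ++ [q])} := by
  have := h.2.2.isHoleOn_cons (x := p) (by simp; omega) (by
    simp only [List.mem_append, List.mem_singleton, not_or]
    exact ⟨fun hp => (h.left hp).1 rfl, hpq.ne⟩) (by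
    intro y hy
    have hhead : (l ++ [q]).head? = l.head? := by
      rw [List.head?_append_of_ne_nil _ h.1]
    have hlast : (l ++ [q]).getLast? = some q := by simp
    rw [hhead, hlast]
    rcases List.mem_append.1 hy with hy | hy
    · rw [(h.left hy).2]
      have := (h.right hy).1
      simp [this]
    · simp at hy
      subst hy
      simp [hpq])
  simpa using this

lemma IsLink.isHoleOn_of_two {p q : V} {l m : List V} (hl : IsLink G p q l)
    (hm : IsLink G p q m) (hpq : ¬ G.Adj p q) (hne : p ≠ q)
    (hlm : ∀ x ∈ l, ∀ y ∈ m, x ≠ y ∧ ¬ G.Adj x y) :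
    ∃ H, IsHoleOn G (l.length + m.length + 2) H := by
  have hm' := hm.symm
  have hpath : IsIndPath G (l ++ (q :: m.reverse)) := by
    apply isIndPath_append hl.isIndPath hm'.2.1
    · intro x hx y hy
      rcases List.mem_cons.1 hy with rfl | hy
      · exact (hl.right hx).1.symm
      · exact (hlm x hx y (by simpa using hy)).1
    · intro x hx y hy
      rcases List.mem_cons.1 hy with rfl | hy
      · rw [G.adj_comm, (hl.right hx).2]; simp
      · have h1 := (hlm x hx y (by simpa using hy)).2
        have h2 := (hm'.left hy).1
        simp [h1, h2]
  have hl0 := List.length_pos_iff.2 hl.1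
  have hm0 := List.length_pos_iff.2 hm.1
  have := hpath.isHoleOn_cons (x := p) (by simp; omega) (by
    simp only [List.mem_append, List.mem_cons, not_or]
    exact ⟨fun hp => (hl.left hp).1 rfl, hne, fun hp => (hm'.right hp).1 rfl⟩) (by
    intro y hy
    have hhead : (l ++ q :: m.reverse).head? = l.head? := by
      rw [List.head?_append_of_ne_nil _ hl.1]
    have hlast : (l ++ q :: m.reverse).getLast? = m.head? := by
      have : m.reverse ≠ [] := by simpa using hm.1
      rw [List.getLast?_append_of_ne_nil _ (by simp), List.getLast?_cons_of_ne_nil this]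
      simp
    rw [hhead, hlast]
    rcases List.mem_append.1 hy with hy | hy
    · rw [(hl.left hy).2]
      constructor
      · exact Or.inl
      · rintro (h | h)
        · exact h
        · have := (hlm y hy y (List.mem_of_head? h)).1
          exact absurd rfl this
    · rcases List.mem_cons.1 hy with rfl | hy
      · simp only [hpq, false_iff, not_or]
        exact ⟨fun h => (hl.right (List.mem_of_head? h)).1 rfl,
          fun h => (hm.right (List.mem_of_head? h)).1 rfl⟩
      · have hy' : y ∈ m := by simpa using hy
        rw [(hm.left hy').2]
        constructor
        · exact Or.inr
        · rintro (h | h)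
          · have := (hlm y (List.mem_of_head? h) y hy').1
            exact absurd rfl this
          · exact h)
  refine ⟨{v | v ∈ p :: (l ++ q :: m.reverse)}, ?_⟩
  convert this using 1
  simp
  omega

end IndPath

/-- A hole `h 0, …, h (k - 1)`, indexed periodically by `ℤ`, together with a set `P` of vertices
that dominates it, such that any two members of `P` can be linked away from the hole. -/
structure DominatedHole {V : Type u} (G : SimpleGraph V) (P : Set V) (k : ℤ) (h : ℤ → V) :
    Prop where
  evenHoleFree : EvenHoleFree G
  noSectorWheel : ∀ (H : Set V) (w : V), ¬ IsSectorWheel G H w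
  odd : k % 2 = 1
  five_le : 5 ≤ k
  isHole : IsHole G (Set.range h)
  periodic : ∀ i, h (i + k) = h i
  adj_iff : ∀ i j, i < j → j < i + k → (G.Adj (h i) (h j) ↔ j = i + 1 ∨ j = i + k - 1)
  ne : ∀ i j, i < j → j < i + k → h i ≠ h j
  notMem : ∀ p ∈ P, ∀ i, p ≠ h i
  link : ∀ p ∈ P, ∀ q ∈ P, p ≠ q → ¬ G.Adj p q →
    ∃ l, IsLink G p q l ∧ ∀ x ∈ l, ∀ i, x ≠ h i ∧ ¬ G.Adj x (h i)
  dominated : ∀ i, ∃ p ∈ P, G.Adj p (h i)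

/-- The vertices `h a, h (a + 1), …, h b`. -/
def arc {V : Type u} (h : ℤ → V) (a b : ℤ) : List V :=
  (List.range (b - a + 1).toNat).map fun t : ℕ => h (a + t)

/-- On the arc from `h a` to `h b`, the vertex `p` sees only the first and `q` only the last
vertex. -/
structure CleanArc {V : Type u} (G : SimpleGraph V) (h : ℤ → V) (k : ℤ) (p q : V) (a b : ℤ) :
    Prop where
  le : a ≤ b
  le_add : b ≤ a + k - 2
  left : ∀ t, a ≤ t → t ≤ b → (G.Adj p (h t) ↔ t = a)
  right : ∀ t, a ≤ t → t ≤ b → (G.Adj q (h t) ↔ t = b)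

/-- `h a` and `h b` are consecutive neighbours of `p` along the hole. -/
structure Sector {V : Type u} (G : SimpleGraph V) (h : ℤ → V) (p : V) (a b : ℤ) : Prop where
  lt : a + 2 ≤ b
  adj_iff : ∀ t, a ≤ t → t ≤ b → (G.Adj p (h t) ↔ t = a ∨ t = b)

section Arc

variable {V : Type u} {G : SimpleGraph V} {P : Set V} {k : ℤ} {h : ℤ → V}

lemma mem_arc {a b : ℤ} {x : V} : x ∈ arc h a b ↔ ∃ t, a ≤ t ∧ t ≤ b ∧ h t = x := by
  simp only [arc, List.mem_map, List.mem_range]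
  constructor
  · rintro ⟨t, ht, rfl⟩
    exact ⟨a + t, by omega, by omega, rfl⟩
  · rintro ⟨t, h1, h2, rfl⟩
    exact ⟨(t - a).toNat, by omega, by congr 1; omega⟩

lemma length_arc {a b : ℤ} : (arc h a b).length = (b - a + 1).toNat := by
  simp [arc]

lemma arc_ne_nil {a b : ℤ} (hab : a ≤ b) : arc h a b ≠ [] := by
  rw [← List.length_pos_iff, length_arc]; omega

lemma head?_arc {a b : ℤ} (hab : a ≤ b) : (arc h a b).head? = some (h a) := by
  rw [List.head?_eq_getElem?, List.getElem?_eq_getElem (by rw [length_arc]; omega)]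
  simp [arc]

lemma getLast?_arc {a b : ℤ} (hab : a ≤ b) : (arc h a b).getLast? = some (h b) := by
  rw [List.getLast?_eq_getElem?, List.getElem?_eq_getElem (by rw [length_arc]; omega)]
  simp only [arc, List.getElem_map, List.getElem_range, List.length_map, List.length_range]
  congr 2
  omega

namespace DominatedHole

lemma h_inj (S : DominatedHole G P k h) {i j a : ℤ} (hi : a ≤ i) (hi' : i < a + k) (hj : a ≤ j)
    (hj' : j < a + k) : h i = h j ↔ i = j := by
  refine ⟨fun hij => ?_, fun hij => hij ▸ rfl⟩
  rcases lt_trichotomy i j with hlt | heq | hlt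
  · exact absurd hij (S.ne i j hlt (by omega))
  · exact heq
  · exact absurd hij.symm (S.ne j i hlt (by omega))

lemma h_periodic (S : DominatedHole G P k h) (i n : ℤ) : h (i + n * k) = h i := by
  have hnat : ∀ (i : ℤ) (m : ℕ), h (i + m * k) = h i := by
    intro i m
    induction m with
    | zero => simp
    | succ m ih => rw [← ih, ← S.periodic (i + m * k)]; congr 1; push_cast; ring
  rcases Int.eq_nat_or_neg n with ⟨m, rfl | rfl⟩
  · exact hnat i m
  · rw [← hnat (i + -(m : ℤ) * k) m]; congr 1; ring

/-- Every index can be moved into a given window. -/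
lemma exists_window (S : DominatedHole G P k h) (a i : ℤ) :
    ∃ j, a ≤ j ∧ j < a + k ∧ h j = h i := by
  have hk := S.five_le
  refine ⟨a + (i - a) % k, ?_, ?_, ?_⟩
  · have := Int.emod_nonneg (i - a) (show k ≠ 0 by omega); omega
  · have := Int.emod_lt_of_pos (i - a) (show 0 < k by omega); omega
  · rw [← S.h_periodic (a + (i - a) % k) ((i - a) / k)]
    congr 1
    have := Int.emod_add_mul_ediv (i - a) k
    linarith [mul_comm k ((i - a) / k)]

lemma reflect (S : DominatedHole G P k h) : DominatedHole G P k (fun i => h (-i)) where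
  evenHoleFree := S.evenHoleFree
  noSectorWheel := S.noSectorWheel
  odd := S.odd
  five_le := S.five_le
  isHole := by
    have : Set.range (fun i => h (-i)) = Set.range h :=
      (Equiv.neg ℤ).surjective.range_comp h
    rw [this]; exact S.isHole
  periodic i := by rw [← S.periodic (-(i + k))]; congr 1; ring
  adj_iff i j h1 h2 := by rw [G.adj_comm, S.adj_iff _ _ (by omega) (by omega)]; omega
  ne i j h1 h2 := (S.ne _ _ (by omega) (by omega)).symm
  notMem p hp i := S.notMem p hp _
  link p hp q hq hne hadj := by
    obtain ⟨l, hl, hl'⟩ := S.link p hp q hq hne hadj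
    exact ⟨l, hl, fun x hx i => hl' x hx _⟩
  dominated i := S.dominated _

lemma isIndPath_arc (S : DominatedHole G P k h) {a b : ℤ} (hb : b ≤ a + k - 2) :
    IsIndPath G (arc h a b) := by
  intro i j hj hij
  rw [length_arc] at hj
  simp only [arc, List.getElem_map, List.getElem_range]
  refine ⟨S.ne _ _ (by omega) (by omega), ?_⟩
  rw [S.adj_iff _ _ (by omega) (by omega)]
  omega

lemma isLink_arc (S : DominatedHole G P k h) {p q : V} (hp : p ∈ P) (hq : q ∈ P) {a b : ℤ}
    (hab : CleanArc G h k p q a b) : IsLink G p q (arc h a b) := by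
  have h1 := hab.le
  have h2 := hab.le_add
  have h5 := S.five_le
  refine isLink_of (arc_ne_nil h1) (S.isIndPath_arc h2) ?_ ?_
  · intro x hx
    obtain ⟨t, h3, h4, rfl⟩ := mem_arc.1 hx
    refine ⟨S.notMem p hp t, ?_⟩
    rw [hab.left t h3 h4, head?_arc h1, Option.some_inj,
      S.h_inj (a := a) (by omega) (by omega) (by omega) (by omega), eq_comm]
  · intro x hx
    obtain ⟨t, h3, h4, rfl⟩ := mem_arc.1 hx
    refine ⟨S.notMem q hq t, ?_⟩
    rw [hab.right t h3 h4, getLast?_arc h1, Option.some_inj,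
      S.h_inj (a := a) (by omega) (by omega) (by omega) (by omega), eq_comm]

lemma exists_isLink (S : DominatedHole G P k h) {p q : V} (hp : p ∈ P) (hq : q ∈ P) {a b : ℤ}
    (hab : CleanArc G h k p q a b ∨ CleanArc G h k q p a b) :
    ∃ l, IsLink G p q l ∧ (l.length : ℤ) = b - a + 1 ∧
      ∀ x ∈ l, ∃ t, a ≤ t ∧ t ≤ b ∧ h t = x := by
  rcases hab with hab | hab
  · have := hab.le
    exact ⟨_, S.isLink_arc hp hq hab, by rw [length_arc]; omega, fun x hx => mem_arc.1 hx⟩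
  · have := hab.le
    exact ⟨_, (S.isLink_arc hq hp hab).symm, by rw [List.length_reverse, length_arc]; omega,
      fun x hx => mem_arc.1 (List.mem_reverse.1 hx)⟩

/-- All clean arcs between `p` and `q` have the same parity. -/
lemma exists_parity (S : DominatedHole G P k h) {p q : V} (hp : p ∈ P) (hq : q ∈ P)
    (hpq : p ≠ q) : ∃ ε : ℤ, (G.Adj p q → ε = 0) ∧ ∀ a b : ℤ,
      CleanArc G h k p q a b ∨ CleanArc G h k q p a b → (G.Adj p q → a < b) →
      (b - a) % 2 = ε := by
  by_cases hadj : G.Adj p q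
  · refine ⟨0, fun _ => rfl, fun a b hab hlt => ?_⟩
    obtain ⟨l, hl, hlen, -⟩ := S.exists_isLink hp hq hab
    have hlt := hlt hadj
    have := S.evenHoleFree _ _ (hl.isHoleOn_of_adj hadj (by omega))
    rw [Nat.even_iff] at this
    omega
  · obtain ⟨m, hm, hmh⟩ := S.link p hp q hq hpq hadj
    refine ⟨(m.length : ℤ) % 2, fun h => absurd h hadj, fun a b hab _ => ?_⟩
    obtain ⟨l, hl, hlen, hlh⟩ := S.exists_isLink hp hq hab
    obtain ⟨H, hH⟩ := hl.isHoleOn_of_two hm hadj hpq (by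
      intro x hx y hy
      obtain ⟨t, -, -, rfl⟩ := hlh x hx
      have := hmh y hy t
      exact ⟨this.1.symm, fun h => this.2 h.symm⟩)
    have := S.evenHoleFree _ _ hH
    rw [Nat.even_iff] at this
    omega

/-- Nonadjacent `p` and `q` do not have two clean arcs far apart from each other. -/
lemma not_two_arcs (S : DominatedHole G P k h) {p q : V} (hp : p ∈ P) (hq : q ∈ P)
    (hpq : p ≠ q) (hadj : ¬ G.Adj p q) {a b c d : ℤ}
    (hab : CleanArc G h k p q a b ∨ CleanArc G h k q p a b)
    (hcd : CleanArc G h k p q c d ∨ CleanArc G h k q p c d)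
    (hbc : b + 2 ≤ c) (hda : d + 2 ≤ a + k) : False := by
  obtain ⟨l, hl, hlen, hlh⟩ := S.exists_isLink hp hq hab
  obtain ⟨m, hm, hlen', hmh⟩ := S.exists_isLink hp hq hcd
  obtain ⟨ε, -, hε⟩ := S.exists_parity hp hq hpq
  have e1 := hε a b hab (fun h => absurd h hadj)
  have e2 := hε c d hcd (fun h => absurd h hadj)
  obtain ⟨H, hH⟩ := hl.isHoleOn_of_two hm hadj hpq (by
    intro x hx y hy
    obtain ⟨t, _, _, rfl⟩ := hlh x hx
    obtain ⟨s, _, _, rfl⟩ := hmh y hy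
    refine ⟨S.ne _ _ (by omega) (by omega), ?_⟩
    rw [S.adj_iff _ _ (by omega) (by omega)]
    omega)
  have := S.evenHoleFree _ _ hH
  rw [Nat.even_iff] at this
  omega

lemma isHoleOn_sector (S : DominatedHole G P k h) {p : V} (hp : p ∈ P) {a b : ℤ}
    (hab : Sector G h p a b) (hb : b ≤ a + k - 2) :
    IsHoleOn G ((b - a + 1).toNat + 1) {v | v ∈ p :: arc h a b} := by
  have h1 := hab.lt
  rw [← length_arc (h := h)]
  apply (S.isIndPath_arc hb).isHoleOn_cons
  · rw [length_arc]; omega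
  · intro hx
    obtain ⟨t, -, -, ht⟩ := mem_arc.1 hx
    exact S.notMem p hp t ht.symm
  · intro y hy
    obtain ⟨t, h3, h4, rfl⟩ := mem_arc.1 hy
    rw [head?_arc (by omega), getLast?_arc (by omega), Option.some_inj, Option.some_inj,
      S.h_inj (a := a) (by omega) (by omega) (by omega) (by omega),
      S.h_inj (a := a) (by omega) (by omega) (by omega) (by omega), hab.adj_iff t h3 h4]
    omega

lemma odd_sector (S : DominatedHole G P k h) {p : V} (hp : p ∈ P) {a b : ℤ}
    (hab : Sector G h p a b) (hb : b ≤ a + k - 2) : (b - a) % 2 = 1 := by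
  have h1 := hab.lt
  have := S.evenHoleFree _ _ (S.isHoleOn_sector hp hab hb)
  rw [Nat.even_iff] at this
  omega

/-- The neighbours of `p` on the hole are not an interval of at least three vertices. -/
lemma not_interval (S : DominatedHole G P k h) {p : V} (hp : p ∈ P) {a b : ℤ}
    (hab : a + 2 ≤ b) (hb : b ≤ a + k - 2)
    (hadj : ∀ t, a ≤ t → t < a + k → (G.Adj p (h t) ↔ t ≤ b)) : False := by
  refine not_isSectorWheel_path (S.noSectorWheel (Set.range h) p) S.isHole ?_
    (S.isIndPath_arc (a := a) (b := b) hb) (by rw [length_arc]; omega) ?_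
  · rintro ⟨i, hi⟩
    exact S.notMem p hp i hi.symm
  · intro y
    rw [mem_arc]
    constructor
    · rintro ⟨t, h1, h2, rfl⟩
      exact ⟨⟨t, rfl⟩, (hadj t h1 (by omega)).2 h2⟩
    · rintro ⟨⟨t, rfl⟩, h2⟩
      obtain ⟨s, h3, h4, h5⟩ := S.exists_window a t
      rw [← h5] at h2 ⊢
      exact ⟨s, h3, (hadj s h3 h4).1 h2, rfl⟩

lemma exists_not_adj (S : DominatedHole G P k h) {p : V} : ∃ i, ¬ G.Adj p (h i) := by
  by_contra! hall
  refine S.noSectorWheel (Set.range h) p ⟨⟨S.isHole, ?_, ?_⟩, Or.inl ?_⟩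
  · rintro ⟨i, rfl⟩
    exact G.irrefl (hall i)
  · have h5 := S.five_le
    have hset : Set.range h ∩ {u | G.Adj p u} = ((arc h 0 (k - 1)).toFinset : Set V) := by
      ext x
      simp only [Set.mem_inter_iff, Set.mem_range, Set.mem_ofPred_eq, List.coe_toFinset, mem_arc]
      constructor
      · rintro ⟨⟨t, rfl⟩, -⟩
        obtain ⟨s, h3, h4, h5⟩ := S.exists_window 0 t
        exact ⟨s, h3, by omega, h5⟩
      · rintro ⟨t, -, -, rfl⟩
        exact ⟨⟨t, rfl⟩, hall t⟩
    rw [hset, Set.ncard_coe_finset, List.toFinset_card_of_nodup, length_arc]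
    · omega
    · rw [arc]
      refine List.Nodup.map_on ?_ List.nodup_range
      intro i hi j hj hij
      rw [List.mem_range] at hi hj
      rw [S.h_inj (a := 0) (by omega) (by omega) (by omega) (by omega)] at hij
      omega
  · rintro _ ⟨i, rfl⟩
    exact hall i

/-- If `q` is adjacent to `p`, its neighbours on a sector of `p` are not the union of an initial
and a final segment with at least two vertices in total. -/
lemma not_segments (S : DominatedHole G P k h) {p q : V} (hp : p ∈ P) (hq : q ∈ P)
    (hpq : G.Adj p q) {a b u v : ℤ} (hab : Sector G h p a b) (hb : b ≤ a + k - 2)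
    (hu : a - 1 ≤ u) (hv : v ≤ b + 1) (huv : u < v) (hcard : 2 ≤ (u - a + 1) + (b - v + 1))
    (hadj : ∀ t, a ≤ t → t ≤ b → (G.Adj q (h t) ↔ t ≤ u ∨ v ≤ t)) : False := by
  have h1 := hab.lt
  have hhole := S.isHoleOn_sector hp hab hb
  have hnp : ∀ a b, p ∉ arc h a b := by
    intro a b hx
    obtain ⟨t, -, -, ht⟩ := mem_arc.1 hx
    exact S.notMem p hp t ht.symm
  rcases eq_or_lt_of_le (show u + 1 ≤ v by omega) with huv' | huv'
  · refine not_isSectorWheel_complete (S.noSectorWheel _ q)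
      (List.nodup_cons.2 ⟨hnp a b, (S.isIndPath_arc hb).nodup⟩) ?_ ⟨_, hhole⟩ ?_
    · rw [List.length_cons, length_arc]; omega
    · intro y hy
      rcases List.mem_cons.1 hy with rfl | hy
      · exact hpq.symm
      · obtain ⟨t, h3, h4, rfl⟩ := mem_arc.1 hy
        exact (hadj t h3 h4).2 (by omega)
  · have hpath : IsIndPath G (p :: arc h a u) := by
      refine isIndPath_cons (S.isIndPath_arc (by omega)) (hnp _ _) ?_
      intro y hy
      obtain ⟨t, h3, h4, rfl⟩ := mem_arc.1 hy
      rw [head?_arc (by omega), Option.some_inj, hab.adj_iff t h3 (by omega),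
        S.h_inj (a := a) (by omega) (by omega) (by omega) (by omega)]
      omega
    refine not_isSectorWheel_path (S.noSectorWheel _ q) ⟨_, hhole⟩ (m := arc h v b ++ p :: arc h a u)
      ?_ (isIndPath_append (S.isIndPath_arc (by omega)) hpath ?_ ?_) ?_ ?_
    · intro hx
      rcases List.mem_cons.1 (show q ∈ p :: arc h a b from hx) with hx | hx
      · exact hpq.ne hx.symm
      · obtain ⟨t, -, -, ht⟩ := mem_arc.1 hx
        exact S.notMem q hq t ht.symm
    · intro x hx y hy
      obtain ⟨t, h3, h4, rfl⟩ := mem_arc.1 hx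
      rcases List.mem_cons.1 hy with rfl | hy
      · exact (S.notMem _ hp t).symm
      · obtain ⟨s, h5, h6, rfl⟩ := mem_arc.1 hy
        exact (S.ne _ _ (by omega) (by omega)).symm
    · intro x hx y hy
      obtain ⟨t, h3, h4, rfl⟩ := mem_arc.1 hx
      rw [getLast?_arc (by omega), Option.some_inj, List.head?_cons, Option.some_inj,
        S.h_inj (a := a) (by omega) (by omega) (by omega) (by omega)]
      rcases List.mem_cons.1 hy with rfl | hy
      · rw [G.adj_comm, hab.adj_iff t (by omega) h4]
        simp
        omega
      · obtain ⟨s, h5, h6, rfl⟩ := mem_arc.1 hy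
        rw [G.adj_comm, S.adj_iff _ _ (by omega) (by omega)]
        have := S.notMem p hp s
        simp only [this, and_false, iff_false]
        omega
    · simp only [List.length_append, List.length_cons, length_arc]; omega
    · intro y
      simp only [List.mem_append, List.mem_cons, mem_arc, Set.mem_ofPred_eq]
      constructor
      · rintro (⟨t, h3, h4, rfl⟩ | rfl | ⟨t, h3, h4, rfl⟩)
        · exact ⟨Or.inr ⟨t, by omega, h4, rfl⟩, (hadj t (by omega) h4).2 (Or.inr h3)⟩
        · exact ⟨Or.inl rfl, hpq.symm⟩
        · exact ⟨Or.inr ⟨t, h3, by omega, rfl⟩, (hadj t h3 (by omega)).2 (Or.inl h4)⟩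
      · rintro ⟨rfl | ⟨t, h3, h4, rfl⟩, h2⟩
        · exact Or.inr (Or.inl rfl)
        · rcases (hadj t h3 h4).1 h2 with h2 | h2
          · exact Or.inr (Or.inr ⟨t, h3, h2, rfl⟩)
          · exact Or.inl ⟨t, h2, h4, rfl⟩

/-- For adjacent `p` and `q`, no vertex is complete to the hole formed by `p`, `q` and a clean
arc. -/
lemma not_complete_of_adj (S : DominatedHole G P k h) {p q r : V} (hp : p ∈ P) (hq : q ∈ P)
    (hpq : G.Adj p q) {a b : ℤ} (hab : CleanArc G h k p q a b) (hlt : a < b)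
    (hrp : G.Adj r p) (hrq : G.Adj r q)
    (hr : ∀ t, a ≤ t → t ≤ b → G.Adj r (h t)) : False := by
  have hl := S.isLink_arc hp hq hab
  have hhole := hl.isHoleOn_of_adj hpq (by rw [length_arc]; omega)
  refine not_isSectorWheel_complete (S.noSectorWheel _ r) (List.nodup_cons.2 ⟨?_, hl.2.2.nodup⟩)
    ?_ ⟨_, hhole⟩ ?_
  · simp only [List.mem_append, List.mem_singleton, not_or]
    exact ⟨fun hx => (hl.left hx).1 rfl, hpq.ne⟩
  · simp only [List.length_append, List.length_cons, length_arc]; omega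
  · intro y hy
    simp only [List.mem_append, List.mem_cons, mem_arc, List.not_mem_nil, or_false] at hy
    rcases hy with rfl | ⟨t, h3, h4, rfl⟩ | rfl
    · exact hrp
    · exact hr t h3 h4
    · exact hrq

end DominatedHole

end Arc

/-- `h i` and `h (i + 1)` are the only neighbours of `p` on the hole. -/
def IsPair {V : Type u} (G : SimpleGraph V) (h : ℤ → V) (p : V) (i : ℤ) : Prop :=
  ∀ j, G.Adj p (h j) ↔ h j = h i ∨ h j = h (i + 1)

/-- `p` has at least two neighbours on the hole, and they are not just two consecutive vertices. -/
def IsWide {V : Type u} (G : SimpleGraph V) (h : ℤ → V) (p : V) : Prop :=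
  (∀ i, ∃ j, G.Adj p (h j) ∧ h j ≠ h i) ∧ ∀ i, ¬ IsPair G h p i

lemma exists_first {Q : ℤ → Prop} {a b : ℤ} (hab : a ≤ b) (hb : Q b) :
    ∃ c, a ≤ c ∧ c ≤ b ∧ Q c ∧ ∀ t, a ≤ t → t < c → ¬ Q t := by
  obtain ⟨c, ⟨h1, h2⟩, h3⟩ := Int.exists_least_of_bdd (P := fun t => a ≤ t ∧ Q t)
    ⟨a, fun z hz => hz.1⟩ ⟨b, hab, hb⟩
  exact ⟨c, h1, h3 b ⟨hab, hb⟩, h2, fun t ht htc hQ => absurd (h3 t ⟨ht, hQ⟩) (by omega)⟩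

lemma exists_last {Q : ℤ → Prop} {a b : ℤ} (hab : a ≤ b) (ha : Q a) :
    ∃ c, a ≤ c ∧ c ≤ b ∧ Q c ∧ ∀ t, c < t → t ≤ b → ¬ Q t := by
  obtain ⟨c, ⟨h1, h2⟩, h3⟩ := Int.exists_greatest_of_bdd (P := fun t => t ≤ b ∧ Q t)
    ⟨b, fun z hz => hz.1⟩ ⟨a, hab, ha⟩
  exact ⟨c, h3 a ⟨hab, ha⟩, h1, h2, fun t hct ht hQ => absurd (h3 t ⟨ht, hQ⟩) (by omega)⟩

section Cover

variable {V : Type u} {G : SimpleGraph V} {P : Set V} {k : ℤ} {h : ℤ → V}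

lemma Sector.reflect {p : V} {a b : ℤ} (hab : Sector G h p a b) :
    Sector G (fun i => h (-i)) p (-b) (-a) where
  lt := by have := hab.lt; omega
  adj_iff t h1 h2 := by rw [hab.adj_iff _ (by omega) (by omega)]; omega

lemma Sector.left {p : V} {a b : ℤ} (hab : Sector G h p a b) : G.Adj p (h a) := by
  have := hab.lt
  exact (hab.adj_iff a le_rfl (by omega)).2 (Or.inl rfl)

lemma Sector.right {p : V} {a b : ℤ} (hab : Sector G h p a b) : G.Adj p (h b) := by
  have := hab.lt
  exact (hab.adj_iff b (by omega) le_rfl).2 (Or.inr rfl)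

lemma Sector.not_adj {p : V} {a b t : ℤ} (hab : Sector G h p a b) (h1 : a < t) (h2 : t < b) :
    ¬ G.Adj p (h t) := by
  rw [hab.adj_iff t h1.le h2.le]; omega

lemma sector_of {p : V} {a b : ℤ} (hlt : a + 2 ≤ b) (ha : G.Adj p (h a)) (hb : G.Adj p (h b))
    (hab : ∀ t, a < t → t < b → ¬ G.Adj p (h t)) : Sector G h p a b := by
  refine ⟨hlt, fun t h1 h2 => ⟨fun ht => ?_, ?_⟩⟩
  · by_contra! hne
    exact hab t (by omega) (by omega) ht
  · rintro (rfl | rfl) <;> assumption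

lemma cleanArc_of {p q : V} {a b : ℤ} (hab : a ≤ b) (hb : b ≤ a + k - 2)
    (hp : G.Adj p (h a)) (hq : G.Adj q (h b)) (hp' : ∀ t, a < t → t ≤ b → ¬ G.Adj p (h t))
    (hq' : ∀ t, a ≤ t → t < b → ¬ G.Adj q (h t)) : CleanArc G h k p q a b := by
  refine ⟨hab, hb, fun t h1 h2 => ⟨fun ht => ?_, ?_⟩, fun t h1 h2 => ⟨fun ht => ?_, ?_⟩⟩
  · by_contra! hne
    exact hp' t (by omega) (by omega) ht
  · rintro rfl; exact hp
  · by_contra! hne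
    exact hq' t (by omega) (by omega) ht
  · rintro rfl; exact hq

/-- A non-neighbour lying between two neighbours is inside a sector. -/
lemma exists_sector_of_between {p : V} {a b x : ℤ} (ha : G.Adj p (h a)) (hb : G.Adj p (h b))
    (hax : a ≤ x) (hxb : x ≤ b) (hx : ¬ G.Adj p (h x)) :
    ∃ i j, a ≤ i ∧ i < x ∧ x < j ∧ j ≤ b ∧ Sector G h p i j := by
  obtain ⟨i, h1, h2, h3, h4⟩ := exists_last (Q := fun t => G.Adj p (h t)) hax ha
  obtain ⟨j, h5, h6, h7, h8⟩ := exists_first (Q := fun t => G.Adj p (h t)) hxb hb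
  have hi : i ≠ x := by rintro rfl; exact hx h3
  have hj : j ≠ x := by rintro rfl; exact hx h7
  refine ⟨i, j, h1, by omega, by omega, h6, sector_of (by omega) h3 h7 fun t ht ht' => ?_⟩
  rcases le_or_gt t x with htx | htx
  · exact h4 t ht htx
  · exact h8 t htx.le ht'

namespace DominatedHole

lemma h_eq_iff (S : DominatedHole G P k h) {i j : ℤ} : h i = h j ↔ ∃ n, i = j + n * k := by
  have hk := S.five_le
  constructor
  · intro hij
    refine ⟨(i - j) / k, ?_⟩
    have h1 := Int.emod_nonneg (i - j) (show k ≠ 0 by omega)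
    have h2 := Int.emod_lt_of_pos (i - j) (show 0 < k by omega)
    have h3 := Int.emod_add_mul_ediv (i - j) k
    have h4 : h (j + (i - j) % k) = h j := by
      rw [← hij, ← S.h_periodic (j + (i - j) % k) ((i - j) / k)]
      congr 1
      linarith [mul_comm k ((i - j) / k)]
    rw [S.h_inj (a := j) (by omega) (by omega) (by omega) (by omega)] at h4
    linarith [mul_comm k ((i - j) / k)]
  · rintro ⟨n, rfl⟩
    exact S.h_periodic j n

lemma h_add (S : DominatedHole G P k h) {i j : ℤ} (hij : h i = h j) (c : ℤ) :
    h (i + c) = h (j + c) := by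
  obtain ⟨n, rfl⟩ := S.h_eq_iff.1 hij
  exact S.h_eq_iff.2 ⟨n, by ring⟩

lemma exists_sector (S : DominatedHole G P k h) {p : V} {x i : ℤ} (hi : G.Adj p (h i))
    (hx : ¬ G.Adj p (h x)) : ∃ a b, a < x ∧ x < b ∧ b ≤ a + k ∧ Sector G h p a b := by
  obtain ⟨j, h1, h2, h3⟩ := S.exists_window x i
  rw [← h3] at hi
  obtain ⟨b, h4, h5, h6, h7⟩ := exists_first (Q := fun t => G.Adj p (h t)) h1 hi
  have h8 : G.Adj p (h (b - k)) := by
    rw [← S.periodic, sub_add_cancel]; exact h6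
  obtain ⟨a', b', h9, h10, h11, h12, h13⟩ :=
    exists_sector_of_between h8 h6 (by omega) (by omega) hx
  exact ⟨a', b', h10, h11, by omega, h13⟩

/-- A sector of a wide vertex misses at least two vertices of the hole. -/
lemma sector_le (S : DominatedHole G P k h) {p : V} (hp : p ∈ P) (hw : IsWide G h p) {a b : ℤ}
    (hab : Sector G h p a b) (hb : b ≤ a + k) : b ≤ a + k - 3 := by
  have hlt := hab.lt
  have hk := S.five_le
  by_cases hz : ∃ z, b < z ∧ z < a + k ∧ G.Adj p (h z)
  · obtain ⟨z, hz1, hz2, hz3⟩ := hz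
    by_contra! hcon
    obtain rfl : z = b + 1 := by omega
    obtain rfl : a = b + 2 - k := by omega
    refine S.not_interval hp (a := b) (b := b + 2) le_rfl (by omega) fun t h1 h2 => ?_
    constructor
    · intro ht
      by_contra! hlt
      rw [← sub_add_cancel t k, S.periodic] at ht
      exact hab.not_adj (by omega) (by omega) ht
    · intro ht
      obtain rfl | rfl | rfl : t = b ∨ t = b + 1 ∨ t = b + 2 := by omega
      · exact hab.right
      · exact hz3
      · have := hab.left
        rwa [← S.periodic, sub_add_cancel] at this
  · push Not at hz
    exfalso
    have honly : ∀ j, G.Adj p (h j) → h j = h a ∨ h j = h b := by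
      intro j hj
      obtain ⟨s, h1, h2, h3⟩ := S.exists_window a j
      rw [← h3] at hj ⊢
      rcases le_or_gt s b with hs | hs
      · rcases (hab.adj_iff s h1 hs).1 hj with rfl | rfl
        · exact Or.inl rfl
        · exact Or.inr rfl
      · exact absurd hj (hz s hs h2)
    obtain rfl | hb' | hb' : b = a + k ∨ b = a + k - 1 ∨ b ≤ a + k - 2 := by omega
    · obtain ⟨j, h1, h2⟩ := hw.1 a
      simp only [S.periodic, or_self] at honly
      exact h2 (honly j h1)
    · refine hw.2 b fun j => ?_
      rw [show b + 1 = a + k by omega, S.periodic]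
      refine ⟨fun hj => (honly j hj).symm, ?_⟩
      rintro (hj | hj) <;> rw [hj]
      · exact hab.right
      · exact hab.left
    · have h1 := S.odd_sector hp hab hb'
      have h2 : Sector G h p b (a + k) := by
        refine sector_of (by omega) hab.right (by rw [S.periodic]; exact hab.left) fun t => hz t
      have h3 := S.odd_sector hp h2 (by omega)
      have := S.odd
      omega

lemma exists_other_sector (S : DominatedHole G P k h) {p : V} (hp : p ∈ P) (hw : IsWide G h p)
    {a b : ℤ} (hab : Sector G h p a b) (hb : b ≤ a + k) :
    ∃ a' b', b ≤ a' ∧ b' ≤ a + k ∧ Sector G h p a' b' := by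
  have hlt := hab.lt
  have hb := S.sector_le hp hw hab hb
  have hak : G.Adj p (h (a + k)) := by rw [S.periodic]; exact hab.left
  by_cases hx : ∃ x, b ≤ x ∧ x ≤ a + k ∧ ¬ G.Adj p (h x)
  · obtain ⟨x, h1, h2, h3⟩ := hx
    obtain ⟨i, j, h4, -, -, h5, h6⟩ := exists_sector_of_between hab.right hak h1 h2 h3
    exact ⟨i, j, h4, h5, h6⟩
  · push Not at hx
    exfalso
    refine S.not_interval hp (a := b) (b := a + k) (by omega) (by omega) fun t h1 h2 => ?_
    refine ⟨fun ht => ?_, fun ht => hx t h1 ht⟩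
    by_contra! hlt
    rw [← sub_add_cancel t k, S.periodic] at ht
    exact hab.not_adj (by omega) (by omega) ht

lemma not_adj_of_pair_in_sector (S : DominatedHole G P k h) {p q : V} (hp : p ∈ P) (hq : q ∈ P)
    (hpq : p ≠ q) (hadj : ¬ G.Adj p q) {a b c : ℤ} (hab : Sector G h p a b) (hb : b ≤ a + k - 3)
    (hac : a ≤ c) (hcb : c + 2 ≤ b)
    (hc : ∀ t, a ≤ t → t ≤ b → (G.Adj q (h t) ↔ t = c ∨ t = c + 1)) {x : ℤ} (hbx : b < x)
    (hxa : x < a + k) : ¬ G.Adj q (h x) := by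
  intro hx0
  obtain ⟨x, h1, h2, hx, hx'⟩ := exists_first (Q := fun t => G.Adj q (h t))
    (show b + 1 ≤ x by omega) hx0
  obtain ⟨y, h3, h4, hy, hy'⟩ := exists_last (Q := fun t => G.Adj p (h t))
    (show b ≤ x by omega) hab.right
  have hqb : ¬ G.Adj q (h b) := by rw [hc b (by omega) le_rfl]; omega
  rcases lt_or_ge x (a + k - 1) with hlt | hge
  · have arc1 : CleanArc G h k p q a c :=
      cleanArc_of hac (by omega) hab.left ((hc c hac (by omega)).2 (Or.inl rfl))
        (fun t _ _ => hab.not_adj (by omega) (by omega))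
        (fun t _ _ => by rw [hc t (by omega) (by omega)]; omega)
    have arc2 : CleanArc G h k p q y x :=
      cleanArc_of h4 (by omega) hy hx hy' fun t _ _ => by
        rcases eq_or_lt_of_le (show b ≤ t by omega) with rfl | h
        · exact hqb
        · exact hx' t (by omega) (by omega)
    exact S.not_two_arcs hp hq hpq hadj (Or.inl arc1) (Or.inl arc2) (by omega) (by omega)
  · obtain rfl : x = a + k - 1 := by omega
    rcases eq_or_lt_of_le hac with rfl | hac
    · refine S.not_interval hq (a := a - 1) (b := a + 1) (by omega) (by omega) fun t h5 h6 => ?_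
      rcases eq_or_lt_of_le h5 with rfl | h5
      · rw [← S.periodic, show a - 1 + k = a + k - 1 by ring]
        simp only [hx, true_iff]
        omega
      · rcases le_or_gt t b with htb | htb
        · rw [hc t (by omega) htb]; omega
        · have := hx' t (by omega) (by omega)
          simp only [this, false_iff]
          omega
    · have arc1 : CleanArc G h k q p (c + 1) b :=
        cleanArc_of (by omega) (by omega) ((hc (c + 1) (by omega) (by omega)).2 (Or.inr rfl))
          hab.right (fun t _ _ => by rw [hc t (by omega) (by omega)]; omega)
          (fun t _ _ => hab.not_adj (by omega) (by omega))
      by_cases hpx : G.Adj p (h (a + k - 1))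
      · have arc2 : CleanArc G h k p q (a + k - 1) (a + k - 1) :=
          cleanArc_of le_rfl (by omega) hpx hx (fun t _ _ => by omega) (fun t _ _ => by omega)
        exact S.not_two_arcs hp hq hpq hadj (Or.inr arc1) (Or.inl arc2) (by omega) (by omega)
      · have arc2 : CleanArc G h k q p (a + k - 1) (a + k) :=
          cleanArc_of (by omega) (by omega) hx (by rw [S.periodic]; exact hab.left)
            (fun t _ _ => by
              obtain rfl : t = a + k := by omega
              rw [S.periodic, hc a le_rfl (by omega)]
              omega)
            (fun t _ _ => by
              obtain rfl : t = a + k - 1 := by omega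
              exact hpx)
        exact S.not_two_arcs hp hq hpq hadj (Or.inr arc1) (Or.inr arc2) (by omega) (by omega)

/-- If `q` sees a vertex that the wide vertex `p` does not see, then `q` sees just a pair or is a
wide vertex adjacent to `p`. -/
lemma isPair_or_isWide (S : DominatedHole G P k h) {p q : V} (hp : p ∈ P) (hq : q ∈ P)
    (hw : IsWide G h p) {x : ℤ} (hpx : ¬ G.Adj p (h x)) (hqx : G.Adj q (h x)) :
    (∃ i, IsPair G h q i) ∨ (G.Adj p q ∧ IsWide G h q) := by
  have hk := S.five_le
  have hpq : p ≠ q := by rintro rfl; exact hpx hqx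
  obtain ⟨i, hi, -⟩ := hw.1 0
  obtain ⟨a, b, hax, hxb, hb, hab⟩ := S.exists_sector hi hpx
  have hb := S.sector_le hp hw hab hb
  have hodd := S.odd_sector hp hab (by omega)
  obtain ⟨c, hc1, hc2, hc, hc'⟩ := exists_first (Q := fun t => G.Adj q (h t)) hax.le hqx
  obtain ⟨d, hd1, hd2, hd, hd'⟩ := exists_last (Q := fun t => G.Adj q (h t)) hxb.le hqx
  have arc1 : CleanArc G h k p q a c :=
    cleanArc_of hc1 (by omega) hab.left hc (fun t _ _ => hab.not_adj (by omega) (by omega)) hc'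
  have arc2 : CleanArc G h k q p d b :=
    cleanArc_of hd2 (by omega) hd hab.right hd' (fun t _ _ => hab.not_adj (by omega) (by omega))
  obtain ⟨ε, hε, hpar⟩ := S.exists_parity hp hq hpq
  by_cases hadj : G.Adj p q
  · have hε := hε hadj
    have hcd : c ≠ d := by
      have e1 : (c - a) % 2 = 0 := by
        rcases eq_or_lt_of_le hc1 with rfl | hlt
        · simp
        · rw [hpar a c (Or.inl arc1) fun _ => hlt, hε]
      have e2 : (b - d) % 2 = 0 := by
        rcases eq_or_lt_of_le hd2 with rfl | hlt
        · simp
        · rw [hpar d b (Or.inr arc2) fun _ => hlt, hε]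
      omega
    by_cases hpair : ∃ i, IsPair G h q i
    · exact Or.inl hpair
    · push Not at hpair
      refine Or.inr ⟨hadj, fun i => ?_, hpair⟩
      by_cases hci : h c = h i
      · refine ⟨d, hd, fun hdi => ?_⟩
        exact S.ne c d (by omega) (by omega) (hci.trans hdi.symm)
      · exact ⟨c, hc, hci⟩
  · left
    have e1 := hpar a c (Or.inl arc1) fun h => absurd h hadj
    have e2 := hpar d b (Or.inr arc2) fun h => absurd h hadj
    have hcd : d = c + 1 := by
      by_contra hne
      exact S.not_two_arcs hp hq hpq hadj (Or.inl arc1) (Or.inr arc2) (by omega) (by omega)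
    subst hcd
    have hq_iff : ∀ t, a ≤ t → t ≤ b → (G.Adj q (h t) ↔ t = c ∨ t = c + 1) := by
      intro t h1 h2
      constructor
      · intro ht
        by_contra! hne
        rcases lt_or_ge t c with hlt | hge
        · exact hc' t h1 hlt ht
        · exact hd' t (by omega) h2 ht
      · rintro (rfl | rfl) <;> assumption
    have hout : ∀ t, b < t → t < a + k → ¬ G.Adj q (h t) := by
      intro t h1 h2
      rcases le_or_gt (c + 2) b with hcb | hcb
      · exact S.not_adj_of_pair_in_sector hp hq hpq hadj hab hb hc1 hcb hq_iff h1 h2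
      · have := S.reflect.not_adj_of_pair_in_sector hp hq hpq hadj hab.reflect
          (by omega) (c := -c - 1) (by omega) (by omega) (fun s h3 h4 => by
            rw [hq_iff _ (by omega) (by omega)]; omega) (x := k - t) (by omega) (by omega)
        rwa [← S.periodic, show -(k - t) + k = t by ring] at this
    refine ⟨c, fun j => ?_⟩
    obtain ⟨s, h1, h2, h3⟩ := S.exists_window a j
    rw [← h3]
    rw [S.h_inj (a := a) (by omega) (by omega) (by omega) (by omega),
      S.h_inj (a := a) (by omega) (by omega) (by omega) (by omega)]
    rcases le_or_gt s b with hs | hs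
    · exact hq_iff s h1 hs
    · have := hout s hs h2
      simp only [this, false_iff]
      omega

lemma isPair_iff (S : DominatedHole G P k h) {p : V} {i t : ℤ} (hp : IsPair G h p i)
    (h1 : i ≤ t) (h2 : t < i + k) : G.Adj p (h t) ↔ t = i ∨ t = i + 1 := by
  have hk := S.five_le
  rw [hp t, S.h_inj (a := i) (by omega) (by omega) (by omega) (by omega),
    S.h_inj (a := i) (by omega) (by omega) (by omega) (by omega)]

lemma isPair_congr (S : DominatedHole G P k h) {p : V} {i j : ℤ} (hp : IsPair G h p i)
    (hij : h i = h j) : IsPair G h p j := by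
  intro t
  rw [hp t, hij, S.h_add hij]

lemma isPair_unique (S : DominatedHole G P k h) {p q : V} (hp : p ∈ P) (hq : q ∈ P) {i j : ℤ}
    (hi : IsPair G h p i) (hj : IsPair G h q j) : h i = h j := by
  have hk := S.five_le
  have hodd := S.odd
  obtain ⟨j', h1, h2, h3⟩ := S.exists_window i j
  have hj := S.isPair_congr hj h3.symm
  rw [← h3]
  rcases eq_or_lt_of_le h1 with rfl | h1
  · rfl
  exfalso
  have hpt : ∀ t, i ≤ t → t < i + k → (G.Adj p (h t) ↔ t = i ∨ t = i + 1) :=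
    fun t => S.isPair_iff hi
  have hqt : ∀ t, j' ≤ t → t < j' + k → (G.Adj q (h t) ↔ t = j' ∨ t = j' + 1) :=
    fun t => S.isPair_iff hj
  have hqt' : ∀ t, j' - k ≤ t → t < j' → (G.Adj q (h t) ↔ t = j' - k ∨ t = j' - k + 1) := by
    intro t h4 h5
    rw [← S.periodic, hqt _ (by omega) (by omega)]
    omega
  have hpt' : ∀ t, i + k ≤ t → t < i + k + k → (G.Adj p (h t) ↔ t = i + k ∨ t = i + k + 1) := by
    intro t h4 h5
    rw [← sub_add_cancel t k, S.periodic, hpt _ (by omega) (by omega)]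
    omega
  have hpq : p ≠ q := by
    rintro rfl
    have e1 := (hpt j' h1.le h2).1 ((hqt j' le_rfl (by omega)).2 (Or.inl rfl))
    have e2 := (hqt' i (by omega) (by omega)).1 ((hpt i le_rfl (by omega)).2 (Or.inl rfl))
    omega
  have arc1 : CleanArc G h k p q (i + 1) j' :=
    cleanArc_of (by omega) (by omega) ((hpt _ (by omega) (by omega)).2 (Or.inr rfl))
      ((hqt _ (by omega) (by omega)).2 (Or.inl rfl))
      (fun t _ _ => by rw [hpt _ (by omega) (by omega)]; omega)
      (fun t _ _ => by rw [hqt' _ (by omega) (by omega)]; omega)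
  have arc2 : CleanArc G h k q p (j' + 1) (i + k) :=
    cleanArc_of (by omega) (by omega) ((hqt _ (by omega) (by omega)).2 (Or.inr rfl))
      ((hpt' _ (by omega) (by omega)).2 (Or.inl rfl))
      (fun t _ _ => by rw [hqt _ (by omega) (by omega)]; omega)
      (fun t _ _ => by rw [hpt _ (by omega) (by omega)]; omega)
  obtain ⟨ε, hε, hpar⟩ := S.exists_parity hp hq hpq
  have e1 := hpar _ _ (Or.inl arc1)
  have e2 := hpar _ _ (Or.inr arc2)
  by_cases hadj : G.Adj p q
  · have hε := hε hadj
    rcases eq_or_lt_of_le (show i + 1 ≤ j' by omega) with hlt | hlt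
    · have := e2 fun _ => by omega
      omega
    · have e1 := e1 fun _ => hlt
      rcases eq_or_lt_of_le (show j' + 1 ≤ i + k by omega) with hlt | hlt
      · omega
      · have e2 := e2 fun _ => hlt
        omega
  · have e1 := e1 fun h => absurd h hadj
    have e2 := e2 fun h => absurd h hadj
    omega

lemma exists_isWide (S : DominatedHole G P k h) : ∃ p ∈ P, IsWide G h p := by
  by_contra! hno
  have hk := S.five_le
  have hodd := S.odd
  obtain ⟨i, hi⟩ : ∃ i, ∀ p ∈ P, ∀ j, IsPair G h p j →
      ¬ G.Adj p (h i) ∧ ¬ G.Adj p (h (i + 2)) := by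
    by_cases hpair : ∃ q ∈ P, ∃ j, IsPair G h q j
    · obtain ⟨q, hq, j, hj⟩ := hpair
      refine ⟨j + 2, fun p hp j' hj' => ?_⟩
      have hp' := S.isPair_congr hj' (S.isPair_unique hp hq hj' hj)
      rw [S.isPair_iff hp' (by omega) (by omega), S.isPair_iff hp' (by omega) (by omega)]
      omega
    · push Not at hpair
      exact ⟨0, fun p hp j hj => absurd hj (hpair p hp j)⟩
  have hsingle : ∀ j, j = i ∨ j = i + 2 → ∃ p ∈ P, ∀ t, G.Adj p (h t) ↔ h t = h j := by
    intro j hj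
    obtain ⟨p, hp, hpj⟩ := S.dominated j
    refine ⟨p, hp, fun t => ⟨fun ht => ?_, fun ht => ht ▸ hpj⟩⟩
    have hnp : ∀ j, ¬ IsPair G h p j := by
      intro j' hj'
      rcases hj with rfl | rfl
      · exact (hi p hp j' hj').1 hpj
      · exact (hi p hp j' hj').2 hpj
    by_contra hne
    refine hno p hp ⟨fun s => ?_, hnp⟩
    by_cases hs : h t = h s
    · exact ⟨j, hpj, fun h => hne (hs.trans h.symm)⟩
    · exact ⟨t, ht, hs⟩
  obtain ⟨p, hp, hp'⟩ := hsingle i (Or.inl rfl)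
  obtain ⟨q, hq, hq'⟩ := hsingle (i + 2) (Or.inr rfl)
  have hne := S.ne i (i + 2) (by omega) (by omega)
  have hpq : p ≠ q := by
    rintro rfl
    exact hne ((hq' i).1 ((hp' i).2 rfl))
  have arc1 : CleanArc G h k p q i (i + 2) :=
    cleanArc_of (by omega) (by omega) ((hp' _).2 rfl) ((hq' _).2 rfl)
      (fun t _ _ => by rw [hp']; exact (S.ne _ _ (by omega) (by omega)).symm)
      (fun t _ _ => by rw [hq']; exact S.ne _ _ (by omega) (by omega))
  have arc2 : CleanArc G h k q p (i + 2) (i + k) :=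
    cleanArc_of (by omega) (by omega) ((hq' _).2 rfl) ((hp' _).2 (S.periodic i))
      (fun t _ _ => by rw [hq']; exact (S.ne _ _ (by omega) (by omega)).symm)
      (fun t _ _ => by rw [hp']; exact (S.ne _ _ (by omega) (by omega)).symm)
  obtain ⟨ε, hε, hpar⟩ := S.exists_parity hp hq hpq
  have e1 := hpar _ _ (Or.inl arc1) fun _ => by omega
  have e2 := hpar _ _ (Or.inr arc2) fun _ => by omega
  omega

/-- If `q` is adjacent to `p`, sees the second vertex of a sector of `p`, and has at most one
sector inside, then its neighbours there form two segments. -/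
lemma exists_two_segments (S : DominatedHole G P k h) {p q : V} (hp : p ∈ P) (hq : q ∈ P)
    (hpq : G.Adj p q) {a b u : ℤ} (hab : Sector G h p a b) (hb : b ≤ a + k - 2)
    (hqa : G.Adj q (h (a + 1)))
    (hgap : ∀ i j, a ≤ i → j ≤ b → Sector G h q i j → (i = a ∧ j = b) ∨ (i = u ∧ j = u + 3)) :
    ∃ w, a ≤ u ∧ u + 3 ≤ w ∧ w ≤ b - 2 ∧
      ∀ t, a ≤ t → t ≤ b → (G.Adj q (h t) ↔ t ≤ u ∨ (u + 3 ≤ t ∧ t ≤ w)) := by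
  have hlt := hab.lt
  obtain ⟨ε, hε, hpar⟩ := S.exists_parity hp hq hpq.ne
  have hε := hε hpq
  have hqa0 : G.Adj q (h a) := by
    by_contra hno
    have arc1 : CleanArc G h k p q a (a + 1) :=
      cleanArc_of (by omega) (by omega) hab.left hqa
        (fun t _ _ => hab.not_adj (by omega) (by omega))
        (fun t _ _ => by obtain rfl : t = a := by omega
                         exact hno)
    have := hpar _ _ (Or.inl arc1) fun _ => by omega
    omega
  obtain ⟨w, hw1, hw2, hw, hw'⟩ := exists_last (Q := fun t => G.Adj q (h t))
    (show a + 1 ≤ b by omega) hqa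
  have hwb : w ≠ b - 1 := by
    rintro rfl
    have arc1 : CleanArc G h k q p (b - 1) b :=
      cleanArc_of (by omega) (by omega) hw hab.right
        (fun t _ _ => hw' t (by omega) (by omega))
        (fun t _ _ => hab.not_adj (by omega) (by omega))
    have := hpar _ _ (Or.inr arc1) fun _ => by omega
    omega
  have hsec : ∀ x, a ≤ x → x ≤ w → ¬ G.Adj q (h x) →
      u < x ∧ x < u + 3 ∧ a + 1 ≤ u ∧ u + 3 ≤ w ∧ Sector G h q u (u + 3) := by
    intro x h1 h2 h3
    have hxa : x ≠ a := by rintro rfl; exact h3 hqa0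
    obtain ⟨i, j, h4, h5, h6, h7, h8⟩ := exists_sector_of_between hqa hw (by omega) h2 h3
    rcases hgap i j (by omega) (by omega) h8 with ⟨rfl, rfl⟩ | ⟨rfl, rfl⟩
    · omega
    · exact ⟨h5, h6, h4, h7, h8⟩
  by_cases hx : ∃ x, a ≤ x ∧ x ≤ w ∧ ¬ G.Adj q (h x)
  · obtain ⟨x, h1, h2, h3⟩ := hx
    obtain ⟨-, -, h4, h5, h6⟩ := hsec x h1 h2 h3
    have hiff : ∀ t, a ≤ t → t ≤ b → (G.Adj q (h t) ↔ t ≤ u ∨ (u + 3 ≤ t ∧ t ≤ w)) := by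
      intro t h7 h8
      constructor
      · intro ht
        by_contra! hcon
        rcases lt_or_ge t (u + 3) with h9 | h9
        · exact h6.not_adj hcon.1 h9 ht
        · exact hw' t (hcon.2 h9) h8 ht
      · intro ht
        by_contra hno
        have := hsec t h7 (by omega) hno
        omega
    refine ⟨w, by omega, h5, ?_, hiff⟩
    by_contra! hcon
    refine S.not_segments hp hq hpq hab hb (u := u) (v := u + 3) (by omega) (by omega) (by omega)
      (by omega) fun t h7 h8 => ?_
    rw [hiff t h7 h8]
    omega
  · push Not at hx
    exfalso
    refine S.not_segments hp hq hpq hab hb (u := w) (v := b + 1) (by omega) le_rfl (by omega)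
      (by omega) fun t h7 h8 => ⟨fun ht => ?_, fun ht => hx t h7 (by omega)⟩
    by_contra! hcon
    exact hw' t hcon.1 h8 ht

/-- A shortest sector of a wide vertex, not counting those whose interior is a pair. -/
lemma exists_minimal_sector (S : DominatedHole G P k h) :
    ∃ p ∈ P, ∃ a b, IsWide G h p ∧ Sector G h p a b ∧ b ≤ a + k ∧
      ¬ (b = a + 3 ∧ ∃ t ∈ P, IsPair G h t (a + 1)) ∧
      ∀ q ∈ P, IsWide G h q → ∀ i j, a ≤ i → j ≤ b → Sector G h q i j →
        (i = a ∧ j = b) ∨ (j = i + 3 ∧ ∃ t ∈ P, IsPair G h t (i + 1)) := by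
  let good (n : ℕ) : Prop := ∃ p ∈ P, ∃ a b, IsWide G h p ∧ Sector G h p a b ∧ b ≤ a + k ∧
      ¬ (b = a + 3 ∧ ∃ t ∈ P, IsPair G h t (a + 1)) ∧ b - a = n
  have hex : ∃ n, good n := by
    obtain ⟨p, hp, hw⟩ := S.exists_isWide
    obtain ⟨x, hx⟩ := S.exists_not_adj (p := p)
    obtain ⟨i, hi, -⟩ := hw.1 0
    obtain ⟨a, b, -, -, hb, hab⟩ := S.exists_sector hi hx
    have hlt := hab.lt
    by_cases hbad : b = a + 3 ∧ ∃ t ∈ P, IsPair G h t (a + 1)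
    · obtain ⟨a', b', h1, h2, hab'⟩ := S.exists_other_sector hp hw hab hb
      have hlt' := hab'.lt
      refine ⟨(b' - a').toNat, p, hp, a', b', hw, hab', by omega, ?_, by omega⟩
      rintro ⟨h3, t', ht', hpt'⟩
      obtain ⟨h4, t, ht, hpt⟩ := hbad
      exact S.ne _ _ (by omega) (by omega) (S.isPair_unique ht ht' hpt hpt')
    · exact ⟨(b - a).toNat, p, hp, a, b, hw, hab, hb, hbad, by omega⟩
  obtain ⟨p, hp, a, b, hw, hab, hb, hgood, hn⟩ := Nat.find_spec hex
  refine ⟨p, hp, a, b, hw, hab, hb, hgood, fun q hq hqw i j hi hj hij => ?_⟩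
  have hlt := hij.lt
  by_contra! hcon
  have hsmall : (j - i).toNat < Nat.find hex := by
    by_cases hia : i = a
    · have := hcon.1 hia; omega
    · omega
  refine Nat.find_min hex hsmall ⟨q, hq, i, j, hqw, hij, by omega, ?_, by omega⟩
  rintro ⟨h1, t, ht, ht'⟩
  exact hcon.2 h1 t ht ht'

lemma false (S : DominatedHole G P k h) : False := by
  have hk := S.five_le
  obtain ⟨p, hp, a, b, hw, hab, hb, hgood, hmin⟩ := S.exists_minimal_sector
  have hlt := hab.lt
  have hb := S.sector_le hp hw hab hb
  have hodd := S.odd_sector hp hab (by omega)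
  obtain ⟨u, hu⟩ : ∃ u, ∀ q ∈ P, IsWide G h q → ∀ i j, a ≤ i → j ≤ b → Sector G h q i j →
      (i = a ∧ j = b) ∨ (i = u ∧ j = u + 3 ∧ ∃ t ∈ P, IsPair G h t (u + 1)) := by
    by_cases hex : ∃ u, a ≤ u ∧ u + 3 ≤ b ∧ ∃ t ∈ P, IsPair G h t (u + 1)
    · obtain ⟨u, h1, h2, t, ht, htp⟩ := hex
      refine ⟨u, fun q hq hqw i j hi hj hij => ?_⟩
      rcases hmin q hq hqw i j hi hj hij with h3 | ⟨h3, t', ht', htp'⟩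
      · exact Or.inl h3
      · have := S.isPair_unique ht' ht htp' htp
        rw [S.h_inj (a := a) (by omega) (by omega) (by omega) (by omega)] at this
        exact Or.inr ⟨by omega, by omega, t, ht, htp⟩
    · refine ⟨0, fun q hq hqw i j hi hj hij => ?_⟩
      rcases hmin q hq hqw i j hi hj hij with h3 | ⟨h3, h4⟩
      · exact Or.inl h3
      · exact absurd ⟨i, hi, by omega, h4⟩ hex
  have hpair : ∀ t ∈ P, ∀ t' ∈ P, ∀ i x, IsPair G h t (i + 1) → (∃ j, IsPair G h t' j) →
      G.Adj t' (h x) → a ≤ i → i + 3 ≤ b → a ≤ x → x ≤ b → x = i + 1 ∨ x = i + 2 := by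
    rintro t ht t' ht' i x hi ⟨j, hj⟩ hx h1 h2 h3 h4
    have hj' := S.isPair_congr hj (S.isPair_unique ht' ht hj hi)
    have := (hj' x).1 hx
    rw [S.h_inj (a := a) (by omega) (by omega) (by omega) (by omega),
      S.h_inj (a := a) (by omega) (by omega) (by omega) (by omega)] at this
    omega
  obtain ⟨q, hq, hqa⟩ := S.dominated (a + 1)
  obtain ⟨r, hr, hrb⟩ := S.dominated (b - 1)
  have hqc := S.isPair_or_isWide hp hq hw (hab.not_adj (by omega) (by omega)) hqa
  have hrc := S.isPair_or_isWide hp hr hw (hab.not_adj (by omega) (by omega)) hrb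
  have hqseg : G.Adj p q → IsWide G h q → ∃ w, a ≤ u ∧ u + 3 ≤ w ∧ w ≤ b - 2 ∧
      (∀ t, a ≤ t → t ≤ b → (G.Adj q (h t) ↔ t ≤ u ∨ (u + 3 ≤ t ∧ t ≤ w))) ∧
      ∃ t ∈ P, IsPair G h t (u + 1) := by
    intro hpq hqw
    obtain ⟨w, h1, h2, h3, h4⟩ := S.exists_two_segments hp hq hpq hab (by omega) hqa
      fun i j hi hj hij => by
        rcases hu q hq hqw i j hi hj hij with h | h
        · exact Or.inl h
        · exact Or.inr ⟨h.1, h.2.1⟩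
    refine ⟨w, h1, h2, h3, h4, ?_⟩
    have hsec : Sector G h q u (u + 3) :=
      ⟨by omega, fun t h5 h6 => by rw [h4 t (by omega) (by omega)]; omega⟩
    rcases hu q hq hqw _ _ (by omega) (by omega) hsec with h | h
    · omega
    · exact h.2.2
  have hrseg : G.Adj p r → IsWide G h r → ∃ w, w ≤ u ∧ a + 2 ≤ w ∧ u + 3 ≤ b ∧
      (∀ t, a ≤ t → t ≤ b → (G.Adj r (h t) ↔ (w ≤ t ∧ t ≤ u) ∨ u + 3 ≤ t)) ∧
      ∃ t ∈ P, IsPair G h t (u + 1) := by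
    intro hpr hrw
    obtain ⟨w, h1, h2, h3, h4⟩ := S.reflect.exists_two_segments hp hr hpr hab.reflect
      (by omega) (u := -(u + 3)) (by rwa [show -(-b + 1) = b - 1 by ring])
      fun i j hi hj hij => by
        have hij' := hij.reflect
        simp only [neg_neg] at hij'
        rcases hu r hr hrw (-j) (-i) (by omega) (by omega) hij' with h | h
        · left; omega
        · right; omega
    have h4' : ∀ t, a ≤ t → t ≤ b → (G.Adj r (h t) ↔ (-w ≤ t ∧ t ≤ u) ∨ u + 3 ≤ t) := by
      intro t h5 h6
      have := h4 (-t) (by omega) (by omega)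
      rw [neg_neg] at this
      rw [this]
      omega
    refine ⟨-w, by omega, by omega, by omega, h4', ?_⟩
    have hsec : Sector G h r u (u + 3) :=
      ⟨by omega, fun t h5 h6 => by rw [h4' t (by omega) (by omega)]; omega⟩
    rcases hu r hr hrw _ _ (by omega) (by omega) hsec with h | h
    · omega
    · exact h.2.2
  rcases hqc with hqc | ⟨hpq, hqw⟩ <;> rcases hrc with hrc | ⟨hpr, hrw⟩
  · obtain ⟨i, hi⟩ := hqc
    have hqb : G.Adj q (h (b - 1)) := by
      obtain ⟨j, hj⟩ := hrc
      have hj' := S.isPair_congr hj (S.isPair_unique hr hq hj hi)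
      rw [hi]
      exact (hj' _).1 hrb
    rcases (hi _).1 hqa with hai | hai
    · have hi' := S.isPair_congr hi hai.symm
      have := (S.isPair_iff hi' (by omega) (by omega)).1 hqb
      exact hgood ⟨by omega, q, hq, hi'⟩
    · have hai' := S.h_add hai (-1)
      simp only [add_neg_cancel_right] at hai'
      have hi' := S.isPair_congr hi hai'.symm
      have := (S.isPair_iff hi' (by omega) (by omega)).1 hqb
      omega
  · obtain ⟨w, h1, h2, h3, -, t, ht, htp⟩ := hrseg hpr hrw
    have := hpair t ht q hq u (a + 1) htp hqc hqa (by omega) h3 (by omega) (by omega)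
    omega
  · obtain ⟨w, h1, h2, h3, -, t, ht, htp⟩ := hqseg hpq hqw
    have := hpair t ht r hr u (b - 1) htp hrc hrb (by omega) (by omega) (by omega) (by omega)
    omega
  · obtain ⟨w, h1, h2, h3, h4, -⟩ := hqseg hpq hqw
    obtain ⟨w', h5, h6, h7, h8, -⟩ := hrseg hpr hrw
    have hqb : ¬ G.Adj q (h (b - 1)) := by rw [h4 _ (by omega) (by omega)]; omega
    rcases S.isPair_or_isWide hq hr hqw hqb hrb with ⟨i, hi⟩ | ⟨hqr, -⟩
    · exact hrw.2 i hi
    · have arc1 : CleanArc G h k q p w b :=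
        cleanArc_of (by omega) (by omega) ((h4 w (by omega) (by omega)).2 (by omega)) hab.right
          (fun t _ _ => by rw [h4 t (by omega) (by omega)]; omega)
          (fun t _ _ => hab.not_adj (by omega) (by omega))
      refine S.not_complete_of_adj hq hp hpq.symm arc1 (by omega) hqr.symm hpr.symm
        fun t _ _ => ?_
      rw [h8 t (by omega) (by omega)]
      omega

end DominatedHole

end Cover

section Layers

variable {V : Type u} {G : SimpleGraph V}

lemma isIndPath_support {p q : V} (w : G.Walk p q)
    (hw : ∀ w' : G.Walk p q, w'.support ⊆ w.support → w.length ≤ w'.length) :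
    IsIndPath G w.support := by
  intro i j hj hij
  rw [SimpleGraph.Walk.length_support] at hj
  rw [SimpleGraph.Walk.support_getElem_eq_getVert, SimpleGraph.Walk.support_getElem_eq_getVert]
  have htake : (w.take i).support ⊆ w.support := (w.isSubwalk_take i).support_subset
  have hdrop : (w.drop j).support ⊆ w.support := (w.isSubwalk_drop j).support_subset
  refine ⟨fun heq => ?_, fun hadj => ?_, ?_⟩
  · have := hw ((w.take i).append ((w.drop j).copy heq.symm rfl)) fun x hx => by
      rw [SimpleGraph.Walk.mem_support_append_iff, SimpleGraph.Walk.support_copy] at hx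
      exact hx.elim (@htake x) (@hdrop x)
    simp at this
    omega
  · have := hw ((w.take i).append (.cons hadj (w.drop j))) fun x hx => by
      rw [SimpleGraph.Walk.mem_support_append_iff, SimpleGraph.Walk.support_cons,
        List.mem_cons] at hx
      rcases hx with hx | rfl | hx
      · exact htake hx
      · exact w.getVert_mem_support i
      · exact hdrop hx
    simp at this
    omega
  · rintro rfl
    exact w.adj_getVert_succ (by omega)

lemma exists_isLink_of_walk {p q : V} (hpq : p ≠ q) (hadj : ¬ G.Adj p q) (w : G.Walk p q) :
    ∃ l, IsLink G p q l ∧ ∀ x ∈ l, x ∈ w.support ∧ x ≠ p ∧ x ≠ q := by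
  have hex : ∃ n, ∃ w' : G.Walk p q, w'.support ⊆ w.support ∧ w'.length = n :=
    ⟨_, w, fun _ hx => hx, rfl⟩
  obtain ⟨w', hsub, hlen⟩ := Nat.find_spec hex
  have hind : IsIndPath G w'.support := isIndPath_support w' fun w'' hw'' =>
    hlen ▸ Nat.find_min' hex ⟨w'', fun x hx => hsub (hw'' hx), rfl⟩
  cases w' with
  | nil => exact absurd rfl hpq
  | cons h t =>
    obtain ⟨l, hl⟩ : ∃ l, t.support = l ++ [q] :=
      ⟨t.support.dropLast, by
        rw [← List.dropLast_append_getLast t.support_ne_nil, SimpleGraph.Walk.getLast_support]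
        simp⟩
    rw [SimpleGraph.Walk.support_cons, hl] at hind hsub
    have hlink : IsLink G p q l := by
      refine ⟨?_, IsIndPath.of_append_left (m := [q]) (by simpa using hind),
        IsIndPath.of_append_right (l := [p]) (by simpa using hind)⟩
      rintro rfl
      have := hind.append_adj (l := [p]) (m := [q]) (x := p) (y := q) (by simp) (by simp)
      exact hadj (this.2.2 (by simp))
    exact ⟨l, hlink, fun x hx =>
      ⟨hsub (by simp [hx]), (hlink.left hx).1.symm, (hlink.right hx).1.symm⟩⟩

lemma dist_le_dist_add_one {r u v : V} (hr : G.Reachable r u) (h : G.Adj u v) :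
    G.dist r v ≤ G.dist r u + 1 := by
  obtain ⟨w, hw⟩ := hr.exists_walk_length_eq_dist
  simpa [hw] using SimpleGraph.dist_le (w.concat h)

lemma exists_adj_dist_eq {r v : V} {m : ℕ} (hr : G.Reachable r v) (hm : G.dist r v = m + 1) :
    ∃ p, G.Reachable r p ∧ G.dist r p = m ∧ G.Adj p v := by
  obtain ⟨w, hw⟩ := hr.exists_walk_length_eq_dist
  have hnil : ¬ w.Nil := by
    rw [SimpleGraph.Walk.not_nil_iff_lt_length]
    omega
  have hadj := w.adj_penultimate hnil
  have h1 := SimpleGraph.dist_le w.dropLast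
  have hreach : G.Reachable r w.penultimate := w.dropLast.reachable
  have h2 := dist_le_dist_add_one hreach hadj
  have h3 : w.dropLast.length = w.length - 1 := by simp
  exact ⟨_, hreach, by omega, hadj⟩

lemma exists_walk_dist_lt {r p : V} {m : ℕ} (hr : G.Reachable r p) (hm : G.dist r p = m) :
    ∃ w : G.Walk r p, ∀ x ∈ w.support, x = p ∨ G.Reachable r x ∧ G.dist r x < m := by
  obtain ⟨w, hw⟩ := hr.exists_walk_length_eq_dist
  refine ⟨w, fun x hx => ?_⟩
  obtain ⟨i, rfl, hi⟩ := SimpleGraph.Walk.mem_support_iff_exists_getVert.1 hx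
  rcases hi.eq_or_lt with rfl | hi
  · exact Or.inl w.getVert_length
  · refine Or.inr ⟨(w.take i).reachable, ?_⟩
    have h1 := SimpleGraph.dist_le (w.take i)
    have h2 : (w.take i).length = min i w.length := by simp
    omega

lemma exists_isLink_dist_lt {r p q : V} {m : ℕ} (hp : G.Reachable r p) (hpm : G.dist r p = m)
    (hq : G.Reachable r q) (hqm : G.dist r q = m) (hpq : p ≠ q) (hadj : ¬ G.Adj p q) :
    ∃ l, IsLink G p q l ∧ ∀ x ∈ l, G.Reachable r x ∧ G.dist r x < m := by
  obtain ⟨u, hu⟩ := exists_walk_dist_lt hp hpm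
  obtain ⟨v, hv⟩ := exists_walk_dist_lt hq hqm
  obtain ⟨l, hl, hmem⟩ := exists_isLink_of_walk hpq hadj (u.reverse.append v)
  refine ⟨l, hl, fun x hx => ?_⟩
  obtain ⟨h1, h2, h3⟩ := hmem x hx
  rw [SimpleGraph.Walk.mem_support_append_iff, SimpleGraph.Walk.support_reverse,
    List.mem_reverse] at h1
  exact h1.elim (fun h => (hu x h).resolve_left h2) (fun h => (hv x h).resolve_left h3)

/-- No hole lies in a single layer of a breadth-first search. -/
lemma not_isHole_of_layer (hEH : EvenHoleFree G)
    (hSW : ∀ (H : Set V) (w : V), ¬ IsSectorWheel G H w) {H : Set V} (hH : IsHole G H)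
    {r : V} {m : ℕ} (hr : ∀ v ∈ H, G.Reachable r v) (hm : ∀ v ∈ H, G.dist r v = m + 1) :
    False := by
  have hole := hH
  obtain ⟨n, hn⟩ := hH
  have hodd := Nat.not_even_iff_odd.1 (hEH n H hn)
  obtain ⟨hn4, f, hinj, rfl, hadj⟩ := hn
  have hodd2 := Nat.odd_iff.1 hodd
  have hmem : ∀ i, f i ∈ Set.range f := fun i => ⟨i, rfl⟩
  have key : ∀ c : ℤ, -n < c → c < n → ((n : ℤ) ∣ c ↔ c = 0) := fun c h1 h2 =>
    ⟨fun h => Int.eq_zero_of_abs_lt_dvd h (abs_lt.2 ⟨h1, h2⟩), fun h => h ▸ dvd_zero _⟩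
  refine DominatedHole.false (G := G) (P := {p | G.Reachable r p ∧ G.dist r p = m}) (k := n)
    (h := fun i => f (i : ZMod n)) ?_
  exact {
    evenHoleFree := hEH
    noSectorWheel := hSW
    odd := by omega
    five_le := by omega
    isHole := by
      convert hole using 1
      exact (ZMod.intCast_surjective (n := n)).range_comp f
    periodic := fun i => by simp
    adj_iff := fun i j h1 h2 => by
      rw [hadj]
      have e1 : ((j : ZMod n) = i + 1) ↔ (n : ℤ) ∣ j - i - 1 := by
        rw [← ZMod.intCast_zmod_eq_zero_iff_dvd, ← sub_eq_zero]
        push_cast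
        ring_nf
      have e2 : ((i : ZMod n) = j + 1) ↔ (n : ℤ) ∣ j - i + 1 - n := by
        rw [← ZMod.intCast_zmod_eq_zero_iff_dvd, eq_comm, ← sub_eq_zero]
        push_cast
        rw [ZMod.natCast_self]
        ring_nf
      rw [e1, e2, key _ (by omega) (by omega), key _ (by omega) (by omega)]
      omega
    ne := fun i j h1 h2 heq => by
      have := hinj heq
      rw [ZMod.intCast_eq_intCast_iff_dvd_sub, key _ (by omega) (by omega)] at this
      omega
    notMem := by
      rintro p ⟨-, hp⟩ i rfl
      have := hm _ (hmem i)
      omega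
    link := by
      rintro p ⟨hp, hpm⟩ q ⟨hq, hqm⟩ hpq hnadj
      obtain ⟨l, hl, hlm⟩ := exists_isLink_dist_lt hp hpm hq hqm hpq hnadj
      refine ⟨l, hl, fun x hx i => ?_⟩
      obtain ⟨h1, h2⟩ := hlm x hx
      have h3 := hm _ (hmem i)
      refine ⟨?_, fun hxi => ?_⟩
      · rintro rfl
        omega
      · have := dist_le_dist_add_one h1 hxi
        omega
    dominated := fun i => by
      obtain ⟨p, h1, h2, h3⟩ := exists_adj_dist_eq (hr _ (hmem i)) (hm _ (hmem i))
      exact ⟨p, ⟨h1, h2⟩, h3⟩ }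

/-- The distance from `v` to a fixed vertex of its component. -/
noncomputable def depth (G : SimpleGraph V) (v : V) : ℕ :=
  G.dist (G.connectedComponentMk v).out v

lemma reachable_out (v : V) : G.Reachable (G.connectedComponentMk v).out v :=
  SimpleGraph.ConnectedComponent.exact (Quot.out_eq _)

lemma chordalSet_of_parity (hEH : EvenHoleFree G)
    (hSW : ∀ (H : Set V) (w : V), ¬ IsSectorWheel G H w) {X : Set V}
    (hX : ∀ u ∈ X, ∀ v ∈ X, depth G u % 2 = depth G v % 2) : ChordalSet G X := by
  intro H hHX hH
  have hole := hH
  obtain ⟨n, hn4, f, hinj, rfl, hadj⟩ := hH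
  have : NeZero n := ⟨by omega⟩
  have hconst : ∀ i : ℕ, G.connectedComponentMk (f i) = G.connectedComponentMk (f 0) ∧
      depth G (f i) = depth G (f 0) := by
    intro i
    induction i with
    | zero => simp
    | succ i ih =>
      have hstep : G.Adj (f i) (f (i + 1 : ℕ)) := by
        rw [hadj]
        exact Or.inl (by push_cast; rfl)
      have hcomp : G.connectedComponentMk (f (i + 1 : ℕ)) = G.connectedComponentMk (f i) :=
        SimpleGraph.ConnectedComponent.sound hstep.symm.reachable
      refine ⟨hcomp.trans ih.1, ?_⟩
      have h1 := dist_le_dist_add_one (reachable_out (f i)) hstep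
      have h2 := dist_le_dist_add_one (reachable_out (f (i + 1 : ℕ))) hstep.symm
      have h3 := hX _ (hHX ⟨(i + 1 : ℕ), rfl⟩) _ (hHX ⟨i, rfl⟩)
      rw [← ih.2]
      unfold depth at h3 ⊢
      rw [hcomp] at h2 h3 ⊢
      omega
  set r := (G.connectedComponentMk (f 0)).out with hr_def
  have hreach : ∀ v ∈ Set.range f, G.Reachable r v := by
    rintro _ ⟨i, rfl⟩
    obtain ⟨i, rfl⟩ := ZMod.natCast_zmod_surjective i
    rw [hr_def, ← (hconst i).1]
    exact reachable_out _
  have hdist : ∀ v ∈ Set.range f, G.dist r v = depth G (f 0) := by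
    rintro _ ⟨i, rfl⟩
    obtain ⟨i, rfl⟩ := ZMod.natCast_zmod_surjective i
    rw [hr_def, ← (hconst i).1]
    exact (hconst i).2
  rcases hd : depth G (f 0) with _ | m
  · have h01 : f 0 = f 1 := by
      rw [hd] at hdist
      rw [← (hreach _ ⟨0, rfl⟩).dist_eq_zero_iff.1 (hdist _ ⟨0, rfl⟩),
        ← (hreach _ ⟨1, rfl⟩).dist_eq_zero_iff.1 (hdist _ ⟨1, rfl⟩)]
    have : G.Adj (f 0) (f 1) := (hadj 0 1).2 (Or.inl (by simp))
    exact G.ne_of_adj this h01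
  · exact not_isHole_of_layer hEH hSW hole hreach fun v hv => (hdist v hv).trans hd

end Layers

/-- Every even-hole-free graph with no sector wheel admits a chordal cover. -/
theorem stmt0 {V : Type u} [Finite V] (G : SimpleGraph V)
    (hEH : EvenHoleFree G)
    (hSW : ∀ (H : Set V) (w : V), ¬ IsSectorWheel G H w) :
    ∃ X1 X2 : Set V, X1 ∪ X2 = Set.univ ∧ ChordalSet G X1 ∧ ChordalSet G X2 := by
  refine ⟨{v | depth G v % 2 = 0}, {v | depth G v % 2 = 1}, ?_,
    chordalSet_of_parity hEH hSW fun u hu v hv => ?_,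
    chordalSet_of_parity hEH hSW fun u hu v hv => ?_⟩
  · ext v
    simpa using Nat.mod_two_eq_zero_or_one _
  · exact hu.trans hv.symm
  · exact hu.trans hv.symm
end

section
/- Let T be a tree and let G = B(T) be an extended nontrivial basic graph with no star cutset. Then B(T) is not minimal non flat path extendable (MNFPE). -/
open Classical

universe u

/-- `H` is nonempty and no vertex of `H` is simplicial in the subgraph induced on `H`. -/
def NoSimplicial {V : Type u} (G : SimpleGraph V) (H : Set V) : Prop :=
  H.Nonempty ∧ ∀ h ∈ H, ∃ a ∈ H, ∃ b ∈ H, G.Adj h a ∧ G.Adj h b ∧ a ≠ b ∧ ¬ G.Adj a b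

lemma IsHole.noSimplicial {V : Type u} {G : SimpleGraph V} {H : Set V} (h : IsHole G H) :
    NoSimplicial G H := by
  obtain ⟨n, hn, f, hinj, rfl, hadj⟩ := h
  have cast_ne : ∀ m : ℕ, 0 < m → m < n → ((m : ℕ) : ZMod n) ≠ 0 := fun m h0 h1 h => by
    rw [ZMod.natCast_eq_zero_iff] at h
    exact absurd (Nat.le_of_dvd h0 h) (by omega)
  have h1 := cast_ne 1 (by omega) (by omega)
  have h2 := cast_ne 2 (by omega) (by omega)
  have h3 := cast_ne 3 (by omega) (by omega)
  push_cast at h1 h2 h3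
  refine ⟨⟨f 0, 0, rfl⟩, ?_⟩
  rintro _ ⟨i, rfl⟩
  refine ⟨f (i + 1), ⟨_, rfl⟩, f (i - 1), ⟨_, rfl⟩, (hadj _ _).2 (Or.inl rfl),
    (hadj _ _).2 (Or.inr (by ring)), fun h => h2 ?_, fun h => ?_⟩
  · linear_combination hinj h
  · rcases (hadj _ _).1 h with h | h
    · exact h3 (by linear_combination -h)
    · exact h1 (by linear_combination h)

/-- A tree in which no two leaves have distance at most two. -/
structure SparseLeaves {W : Type u} (T : SimpleGraph W) : Prop where
  isTree : T.IsTree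
  twin_eq : ∀ p u v : W, IsLeaf T u → IsLeaf T v → T.Adj p u → T.Adj p v → u = v
  not_leaf_of_adj : ∀ u v : W, IsLeaf T u → T.Adj u v → ¬ IsLeaf T v

section

open SimpleGraph

variable {W : Type u} {T : SimpleGraph W} {c : W → Bool}

lemma bGraph_adj_edge_edge {e f : T.edgeSet} :
    (BGraph T c).Adj (Sum.inl e) (Sum.inl f) ↔ e ≠ f ∧ ∃ v : W, v ∈ e.1 ∧ v ∈ f.1 := by
  simp only [BGraph, fromRel_adj, ne_eq, Sum.inl.injEq]
  grind

lemma bGraph_adj_edge_apex {e : T.edgeSet} {i : Bool} :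
    (BGraph T c).Adj (Sum.inl e) (Sum.inr i) ↔ ∃ v : W, IsLeaf T v ∧ c v = i ∧ v ∈ e.1 := by
  simp [BGraph, fromRel_adj]

lemma bGraph_adj_apex_apex {i j : Bool} :
    (BGraph T c).Adj (Sum.inr i) (Sum.inr j) ↔ i ≠ j := by
  simp [BGraph, fromRel_adj]

lemma edge_eq_mk {e : T.edgeSet} {p v : W} (hp : p ∈ e.1) (hv : v ∈ e.1) (hne : p ≠ v) :
    e.1 = s(p, v) :=
  (Sym2.mem_and_mem_iff hne).1 ⟨hp, hv⟩

lemma edge_ext {e f : T.edgeSet} {p v : W} (hne : p ≠ v) (hp : p ∈ e.1) (hv : v ∈ e.1)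
    (hp' : p ∈ f.1) (hv' : v ∈ f.1) : e = f :=
  Subtype.ext ((edge_eq_mk hp hv hne).trans (edge_eq_mk hp' hv' hne).symm)

lemma adj_of_mem_edge {e : T.edgeSet} {p v : W} (hp : p ∈ e.1) (hv : v ∈ e.1) (hne : p ≠ v) :
    T.Adj p v := by
  have h := e.2
  rwa [edge_eq_mk hp hv hne] at h

lemma exists_other_end (e : T.edgeSet) {p : W} (hp : p ∈ e.1) :
    ∃ v, v ∈ e.1 ∧ p ≠ v ∧ T.Adj p v := by
  obtain ⟨v, hv⟩ := Sym2.mem_iff_exists.1 hp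
  have h : T.Adj p v := by have h := e.2; rwa [hv] at h
  exact ⟨v, hv ▸ Sym2.mem_mk_right _ _, h.ne, h⟩

lemma end_eq_or_eq {e : T.edgeSet} {p v z : W} (hp : p ∈ e.1) (hv : v ∈ e.1) (hne : p ≠ v)
    (hz : z ∈ e.1) : z = p ∨ z = v := by
  rw [edge_eq_mk hp hv hne] at hz
  exact Sym2.mem_iff.1 hz

lemma IsLeaf.adj_unique {v p q : W} (h : IsLeaf T v) (hp : T.Adj v p) (hq : T.Adj v q) :
    p = q := by
  obtain ⟨a, ha⟩ := Set.ncard_eq_one.1 h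
  have h1 : p ∈ ({a} : Set W) := ha ▸ hp
  have h2 : q ∈ ({a} : Set W) := ha ▸ hq
  exact h1.trans h2.symm

lemma IsLeaf.exists_adj {v : W} (h : IsLeaf T v) : ∃ p, T.Adj v p := by
  obtain ⟨a, ha⟩ := Set.ncard_eq_one.1 h
  exact ⟨a, (ha ▸ rfl : a ∈ {u | T.Adj v u})⟩

lemma IsLeaf.edge_unique {v : W} (h : IsLeaf T v) {e f : T.edgeSet} (he : v ∈ e.1)
    (hf : v ∈ f.1) : e = f := by
  obtain ⟨p, hp, hne, hadj⟩ := exists_other_end e he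
  obtain ⟨q, hq, -, hadj'⟩ := exists_other_end f hf
  obtain rfl := h.adj_unique hadj hadj'
  exact edge_ext hne he hp hf hq

lemma IsLeaf.exists_edge {v : W} (h : IsLeaf T v) : ∃ e : T.edgeSet, v ∈ e.1 := by
  obtain ⟨p, hp⟩ := h.exists_adj
  exact ⟨⟨s(v, p), hp⟩, Sym2.mem_mk_left _ _⟩

lemma SparseLeaves.leaf_edge_unique (hT : SparseLeaves T) {e f : T.edgeSet} {p u v : W}
    (hp : p ∈ e.1) (hp' : p ∈ f.1) (hu : IsLeaf T u) (hue : u ∈ e.1) (hpu : p ≠ u)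
    (hv : IsLeaf T v) (hvf : v ∈ f.1) (hpv : p ≠ v) : u = v ∧ e = f := by
  obtain rfl := hT.twin_eq p u v hu hv (adj_of_mem_edge hp hue hpu) (adj_of_mem_edge hp' hvf hpv)
  exact ⟨rfl, hu.edge_unique hue hvf⟩

lemma SparseLeaves.leaf_mem_unique (hT : SparseLeaves T) {e : T.edgeSet} {u v : W}
    (hu : IsLeaf T u) (hue : u ∈ e.1) (hv : IsLeaf T v) (hve : v ∈ e.1) : u = v := by
  by_contra hne
  exact hT.not_leaf_of_adj u v hu (adj_of_mem_edge hue hve hne) hv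

/-- An edge of a simplicial-vertex-free set that is the only such edge at one of its ends
is joined to an apex and to a further edge at its other end. -/
lemma exists_apex_of_unique_at_end {H : Set (T.edgeSet ⊕ Bool)}
    (hH : NoSimplicial (BGraph T c) H) {e : T.edgeSet} (heH : Sum.inl e ∈ H) {p v : W}
    (hp : p ∈ e.1) (hv : v ∈ e.1) (hne : p ≠ v)
    (huniq : ∀ f : T.edgeSet, Sum.inl f ∈ H → v ∈ f.1 → f = e) :
    ∃ u, IsLeaf T u ∧ u ∈ e.1 ∧ Sum.inr (c u) ∈ H ∧
      ∃ f : T.edgeSet, Sum.inl f ∈ H ∧ f ≠ e ∧ p ∈ f.1 := by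
  have key : ∀ f : T.edgeSet, Sum.inl f ∈ H → (BGraph T c).Adj (Sum.inl e) (Sum.inl f) →
      f ≠ e ∧ p ∈ f.1 := by
    intro f hf hadj
    obtain ⟨hne', z, hz, hz'⟩ := bGraph_adj_edge_edge.1 hadj
    rcases end_eq_or_eq hp hv hne hz with rfl | rfl
    · exact ⟨hne'.symm, hz'⟩
    · exact absurd (huniq f hf hz').symm hne'
  obtain ⟨a, ha, b, hb, hea, heb, hab, hnab⟩ := hH.2 _ heH
  rcases a with a | i <;> rcases b with b | j
  · obtain ⟨-, h1⟩ := key a ha hea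
    obtain ⟨-, h2⟩ := key b hb heb
    exact absurd (bGraph_adj_edge_edge.2 ⟨fun h => hab (congrArg _ h), p, h1, h2⟩) hnab
  · obtain ⟨u, hu, rfl, hue⟩ := bGraph_adj_edge_apex.1 heb
    exact ⟨u, hu, hue, hb, a, ha, key a ha hea⟩
  · obtain ⟨u, hu, rfl, hue⟩ := bGraph_adj_edge_apex.1 hea
    exact ⟨u, hu, hue, ha, b, hb, key b hb heb⟩
  · exact absurd (bGraph_adj_apex_apex.2 fun h => hab (congrArg _ h)) hnab

lemma SparseLeaves.apex_mem_of_leaf_edge_mem (hT : SparseLeaves T)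
    {H : Set (T.edgeSet ⊕ Bool)} (hH : NoSimplicial (BGraph T c) H) {e : T.edgeSet}
    (heH : Sum.inl e ∈ H) {v : W} (hv : IsLeaf T v) (hve : v ∈ e.1) : Sum.inr (c v) ∈ H := by
  obtain ⟨p, hp, hne, -⟩ := exists_other_end e hve
  obtain ⟨u, hu, hue, h, -⟩ := exists_apex_of_unique_at_end hH heH hp hve hne.symm
    (fun f _ hf => hv.edge_unique hf hve)
  rwa [hT.leaf_mem_unique hv hve hu hue]

/-- The ends of an edge of a tree are at consecutive distances from a root. -/
lemma exists_oriented_ends (hT : T.IsTree) (r : W) (e : T.edgeSet) :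
    ∃ p v, p ∈ e.1 ∧ v ∈ e.1 ∧ p ≠ v ∧ T.dist r v = T.dist r p + 1 := by
  obtain ⟨e, he⟩ := e
  induction e using Sym2.ind with
  | _ x y =>
    have hxy : T.Adj x y := he
    rcases hT.dist_eq_dist_add_one_of_adj r hxy with h | h
    · exact ⟨y, x, by simp, by simp, hxy.ne.symm, h⟩
    · exact ⟨x, y, by simp, by simp, hxy.ne, h⟩

lemma parent_unique (hT : T.IsTree) {r p q v : W} (hp : T.Adj p v) (hq : T.Adj q v)
    (hdp : T.dist r v = T.dist r p + 1) (hdq : T.dist r v = T.dist r q + 1) : p = q := by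
  obtain ⟨a, ha⟩ := hT.connected.exists_walk_length_eq_dist r p
  obtain ⟨b, hb⟩ := hT.connected.exists_walk_length_eq_dist r q
  have h1 := (a.concat hp).isPath_of_length_eq_dist (by simp [ha, hdp])
  have h2 := (b.concat hq).isPath_of_length_eq_dist (by simp [hb, hdq])
  have h := congrArg (fun w : T.Path r v => w.1.penultimate)
    ((hT.isAcyclic.subsingleton_path r v).elim ⟨_, h1⟩ ⟨_, h2⟩)
  simpa using h

lemma exists_parent (hT : T.IsTree) {r v : W} (hne : v ≠ r) :
    ∃ p, T.Adj p v ∧ T.dist r v = T.dist r p + 1 := by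
  obtain ⟨a, ha⟩ := hT.connected.exists_walk_length_eq_dist r v
  have hnil : ¬ a.Nil := fun h => hne h.eq.symm
  have hadj := a.adj_penultimate hnil
  refine ⟨_, hadj, ?_⟩
  have h1 := dist_le a.dropLast
  have h2 : a.dropLast.length + 1 = a.length := by
    have := congrArg Walk.length (a.concat_dropLast hadj)
    rwa [Walk.length_concat] at this
  rcases hT.dist_eq_dist_add_one_of_adj r hadj with h | h <;> omega

lemma SparseLeaves.not_leaf_of_child (hT : SparseLeaves T) {r p v : W} (hr : ¬ IsLeaf T r)
    (hadj : T.Adj p v) (hd : T.dist r v = T.dist r p + 1) : ¬ IsLeaf T p := by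
  intro hp
  have hne : p ≠ r := fun h => hr (h ▸ hp)
  obtain ⟨q, hq, hdq⟩ := exists_parent hT.isTree hne
  obtain rfl := hp.adj_unique hadj hq.symm
  omega

/-- A hole of `B(T)` contains two leaf edges together with their apexes. -/
lemma SparseLeaves.exists_two_leaf_edges [Finite W] (hT : SparseLeaves T)
    {H : Set (T.edgeSet ⊕ Bool)} (hH : NoSimplicial (BGraph T c) H) :
    ∃ u v, u ≠ v ∧ IsLeaf T u ∧ IsLeaf T v ∧ Sum.inr (c u) ∈ H ∧ Sum.inr (c v) ∈ H ∧
      ∃ e f : T.edgeSet, u ∈ e.1 ∧ v ∈ f.1 ∧ Sum.inl e ∈ H ∧ Sum.inl f ∈ H := by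
  obtain ⟨r⟩ := hT.isTree.connected.nonempty
  have hapex : ∃ i : Bool, Sum.inr i ∈ H := by
    obtain ⟨h, hh⟩ := hH.1
    rcases h with e | i
    · choose hi lo hhi hlo hne hd using exists_oriented_ends hT.isTree r
      obtain ⟨m, hm, hmax⟩ := Set.exists_max_image {e : T.edgeSet | Sum.inl e ∈ H}
        (fun e => T.dist r (lo e)) (Set.toFinite _) ⟨e, hh⟩
      obtain ⟨u, -, -, hu, -⟩ := exists_apex_of_unique_at_end hH hm (hhi m) (hlo m) (hne m)
        (fun f hf hvf => by
          have h1 := hmax f hf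
          have h2 := hd f
          have h3 := hd m
          rcases end_eq_or_eq (hhi f) (hlo f) (hne f) hvf with h | h
          · rw [h] at h1 h3
            omega
          · have hadj := adj_of_mem_edge (hhi f) (hlo f) (hne f)
            rw [← h] at hadj h2
            have h4 := parent_unique hT.isTree hadj
              (adj_of_mem_edge (hhi m) (hlo m) (hne m)) h2 h3
            exact edge_ext (hne m) (h4 ▸ hhi f) hvf (hhi m) (hlo m))
      exact ⟨_, hu⟩
    · exact ⟨i, hh⟩
  obtain ⟨i, hi⟩ := hapex
  have key : ∀ (i : Bool) (e : T.edgeSet), (BGraph T c).Adj (Sum.inr i) (Sum.inl e) →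
      ∃ u, IsLeaf T u ∧ c u = i ∧ u ∈ e.1 := fun i e h => bGraph_adj_edge_apex.1 h.symm
  have key' : ∀ i j : Bool, i ≠ j → Sum.inr i ∈ H → Sum.inr j ∈ H → ∀ e : T.edgeSet,
      Sum.inl e ∈ H → (BGraph T c).Adj (Sum.inr i) (Sum.inl e) →
      ∃ u v, u ≠ v ∧ IsLeaf T u ∧ IsLeaf T v ∧ Sum.inr (c u) ∈ H ∧ Sum.inr (c v) ∈ H ∧
        ∃ e f : T.edgeSet, u ∈ e.1 ∧ v ∈ f.1 ∧ Sum.inl e ∈ H ∧ Sum.inl f ∈ H := by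
    intro i j hij hi hj e he hadj
    obtain ⟨u, hu, rfl, hue⟩ := key _ _ hadj
    obtain ⟨a, ha, b, hb, hja, hjb, hab, -⟩ := hH.2 _ hj
    have : ∃ f : T.edgeSet, Sum.inl f ∈ H ∧ (BGraph T c).Adj (Sum.inr j) (Sum.inl f) := by
      rcases a with a | k
      · exact ⟨a, ha, hja⟩
      · rcases b with b | l
        · exact ⟨b, hb, hjb⟩
        · have h1 := bGraph_adj_apex_apex.1 hja
          have h2 := bGraph_adj_apex_apex.1 hjb
          have h3 : k ≠ l := fun h => hab (h ▸ rfl)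
          revert h1 h2 h3
          cases j <;> cases k <;> cases l <;> simp
    obtain ⟨f, hf, hjf⟩ := this
    obtain ⟨v, hv, rfl, hvf⟩ := key _ _ hjf
    exact ⟨u, v, fun h => hij (h ▸ rfl), hu, hv, hi, hj, e, f, hue, hvf, he, hf⟩
  obtain ⟨a, ha, b, hb, hia, hib, hab, hnab⟩ := hH.2 _ hi
  rcases a with a | j <;> rcases b with b | k
  · obtain ⟨u, hu, rfl, hua⟩ := key _ _ hia
    obtain ⟨v, hv, hcv, hvb⟩ := key _ _ hib
    refine ⟨u, v, ?_, hu, hv, hi, hcv ▸ hi, a, b, hua, hvb, ha, hb⟩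
    rintro rfl
    exact hab (congrArg _ (hu.edge_unique hua hvb))
  · exact key' _ _ (bGraph_adj_apex_apex.1 hib) hi hb a ha hia
  · exact key' _ _ (bGraph_adj_apex_apex.1 hia) hi ha b hb hib
  · exact absurd (bGraph_adj_apex_apex.2 fun h => hab (congrArg _ h)) hnab

end

section

open SimpleGraph

variable {W : Type u} {T : SimpleGraph W} {c : W → Bool}

lemma bGraph_reachable_of_common_end {e f : T.edgeSet} {p : W} (he : p ∈ e.1) (hf : p ∈ f.1) :
    (BGraph T c).Reachable (Sum.inl e) (Sum.inl f) := by
  by_cases h : e = f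
  · rw [h]
  · exact (bGraph_adj_edge_edge.2 ⟨h, p, he, hf⟩).reachable

lemma bGraph_connected (hT : T.Connected) {l : W} (hl : IsLeaf T l) :
    (BGraph T c).Connected := by
  have hwalk : ∀ {u v : W} (_ : T.Walk u v) (e f : T.edgeSet), u ∈ e.1 → v ∈ f.1 →
      (BGraph T c).Reachable (Sum.inl e) (Sum.inl f) := by
    intro u v w
    induction w with
    | nil => exact fun e f he hf => bGraph_reachable_of_common_end he hf
    | cons h w ih =>
      intro e f he hf
      exact (bGraph_reachable_of_common_end he (Sym2.mem_mk_left _ _)).trans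
        (ih ⟨_, h⟩ f (Sym2.mem_mk_right _ _) hf)
  obtain ⟨e, hle⟩ := hl.exists_edge
  have hbase : (BGraph T c).Reachable (Sum.inl e) (Sum.inr (c l)) :=
    (bGraph_adj_edge_apex.2 ⟨l, hl, rfl, hle⟩).reachable
  have hall : ∀ z, (BGraph T c).Reachable (Sum.inl e) z := by
    rintro (f | i)
    · obtain ⟨w⟩ := hT l f.1.out.1
      exact hwalk w e f hle (Sym2.out_fst_mem _)
    · by_cases h : c l = i
      · exact h ▸ hbase
      · exact hbase.trans (bGraph_adj_apex_apex.2 h).reachable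
  exact (connected_iff _).2 ⟨fun x y => (hall x).symm.trans (hall y), ⟨Sum.inr true⟩⟩

lemma twin_leaves_eq (hT : T.Connected) (hc : ∀ u v : W, T.Adj u v → c u ≠ c v)
    (hSC : ¬ HasStarCutset (BGraph T c)) {p u v : W} (hu : IsLeaf T u) (hv : IsLeaf T v)
    (hpu : T.Adj p u) (hpv : T.Adj p v) : u = v := by
  by_contra huv
  have hp : ¬ IsLeaf T p := fun h => huv (h.adj_unique hpu hpv)
  set e : T.edgeSet := ⟨s(p, u), hpu⟩ with he
  set f : T.edgeSet := ⟨s(p, v), hpv⟩ with hf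
  have hef : e ≠ f := fun h => by
    have h1 : u ∈ f.1 := h ▸ Sym2.mem_mk_right _ _
    rcases Sym2.mem_iff.1 h1 with h | h
    · exact hpu.ne h.symm
    · exact huv h
  have hcuv : c u = c v := by
    have h1 := hc p u hpu
    have h2 := hc p v hpv
    revert h1 h2
    cases c p <;> cases c u <;> cases c v <;> simp
  apply hSC
  refine ⟨bGraph_connected hT hu, Sum.inl e,
    insert (Sum.inl e) {z | (BGraph T c).Adj (Sum.inl e) z} \ {Sum.inl f},
    ⟨Set.mem_insert _ _, fun h => hef (Sum.inl.inj h)⟩, Set.sdiff_subset, fun hconn => ?_⟩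
  set C := insert (Sum.inl e) {z | (BGraph T c).Adj (Sum.inl e) z} \ {Sum.inl f} with hC
  have hfC : Sum.inl f ∈ Cᶜ := fun h => h.2 rfl
  have hxC : Sum.inr (!c u) ∈ Cᶜ := by
    rintro ⟨h | h, -⟩
    · cases h
    · obtain ⟨z, hz, hcz, hze⟩ := bGraph_adj_edge_apex.1 h
      rcases Sym2.mem_iff.1 hze with rfl | rfl
      · exact hp hz
      · simp at hcz
  obtain ⟨w⟩ := hconn.preconnected ⟨_, hfC⟩ ⟨_, hxC⟩
  cases w with
  | @cons _ z _ hadj w =>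
    obtain ⟨z, hz⟩ := z
    have hadj : (BGraph T c).Adj (Sum.inl f) z := hadj
    apply hz
    rcases z with g | i
    · obtain ⟨hfg, a, haf, hag⟩ := bGraph_adj_edge_edge.1 hadj
      refine ⟨?_, fun h => hfg (Sum.inl.inj h).symm⟩
      rcases Sym2.mem_iff.1 haf with rfl | rfl
      · by_cases heg : e = g
        · exact Or.inl (heg ▸ rfl)
        · exact Or.inr ((bGraph_adj_edge_edge (c := c)).2 ⟨heg, a, Sym2.mem_mk_left _ _, hag⟩)
      · exact absurd (hv.edge_unique (Sym2.mem_mk_right _ _) hag) hfg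
    · obtain ⟨a, ha, rfl, haf⟩ := bGraph_adj_edge_apex.1 hadj
      refine ⟨Or.inr (bGraph_adj_edge_apex.2 ⟨u, hu, ?_, Sym2.mem_mk_right _ _⟩), fun h => ?_⟩
      · rcases Sym2.mem_iff.1 haf with rfl | rfl
        · exact absurd ha hp
        · exact hcuv
      · cases h

lemma not_leaf_of_adj_leaf (hT : T.Connected)
    (hleaves : 3 ≤ ({v | IsLeaf T v} : Set W).ncard) {u v : W} (hu : IsLeaf T u)
    (huv : T.Adj u v) : ¬ IsLeaf T v := by
  intro hv
  have hwalk : ∀ {a b : W} (_ : T.Walk a b), a ∈ ({u, v} : Set W) → b ∈ ({u, v} : Set W) := by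
    intro a b w
    induction w with
    | nil => exact id
    | cons h w ih =>
      rintro (rfl | rfl)
      · exact ih (Or.inr (hu.adj_unique h huv))
      · exact ih (Or.inl (hv.adj_unique h huv.symm))
  have h1 : {v | IsLeaf T v} ⊆ ({u, v} : Set W) := fun b _ => by
    obtain ⟨w⟩ := hT u b
    exact hwalk w (Or.inl rfl)
  have h2 := Set.ncard_le_ncard h1 (Set.toFinite _)
  have h3 := Set.ncard_insert_le u {v}
  rw [Set.ncard_singleton] at h3
  omega

lemma sparseLeaves_of_no_starCutset (hT : T.IsTree) (hc : ∀ u v : W, T.Adj u v → c u ≠ c v)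
    (hleaves : 3 ≤ ({v | IsLeaf T v} : Set W).ncard)
    (hSC : ¬ HasStarCutset (BGraph T c)) : SparseLeaves T where
  isTree := hT
  twin_eq _ _ _ hu hv hpu hpv := twin_leaves_eq hT.connected hc hSC hu hv hpu hpv
  not_leaf_of_adj _ _ hu huv := not_leaf_of_adj_leaf hT.connected hleaves hu huv

end

section

variable {V : Type u} {G : SimpleGraph V}

/-- One of any three vertices of a flat path is interior, so it has degree two and both its
neighbors lie on the path. -/
lemma IsFlatPath.neighbors_subset_of_three {l : List V} (hl : IsFlatPath G l) {x y z : V}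
    (hx : x ∈ l) (hy : y ∈ l) (hz : z ∈ l) (hxy : x ≠ y) (hxz : x ≠ z) (hyz : y ≠ z) :
    ∃ t ∈ ({x, y, z} : Set V), {u | G.Adj t u}.ncard = 2 ∧ {u | G.Adj t u} ⊆ {v | v ∈ l} := by
  obtain ⟨⟨-, hnodup, hadj⟩, hflat⟩ := hl
  have inner : ∀ i (hi : i < l.length), 0 < i → i + 1 < l.length →
      {u | G.Adj l[i] u}.ncard = 2 ∧ {u | G.Adj l[i] u} ⊆ {v | v ∈ l} := by
    intro i hi h0 h1
    have h2 : {u | G.Adj l[i] u}.ncard = 2 := hflat i hi h0 h1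
    refine ⟨h2, ?_⟩
    have hsub : ({l[i - 1], l[i + 1]} : Set V) ⊆ {u | G.Adj l[i] u} := by
      rintro _ (rfl | rfl)
      · exact (hadj i (i - 1) hi (by omega)).2 (by omega)
      · exact (hadj i (i + 1) hi (by omega)).2 (by omega)
    have hcard : ({l[i - 1], l[i + 1]} : Set V).ncard = 2 :=
      Set.ncard_pair fun h => by
        have := (hnodup.getElem_inj_iff).1 h
        omega
    rw [← Set.eq_of_subset_of_ncard_le hsub (by rw [hcard]; exact h2.le)
      (Set.finite_of_ncard_ne_zero (by rw [h2]; norm_num))]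
    rintro _ (rfl | rfl) <;> exact List.getElem_mem _
  obtain ⟨i, hi, rfl⟩ := List.getElem_of_mem hx
  obtain ⟨j, hj, rfl⟩ := List.getElem_of_mem hy
  obtain ⟨k, hk, rfl⟩ := List.getElem_of_mem hz
  have hij : i ≠ j := fun h => hxy (by simp [h])
  have hik : i ≠ k := fun h => hxz (by simp [h])
  have hjk : j ≠ k := fun h => hyz (by simp [h])
  by_cases h1 : 0 < i ∧ i + 1 < l.length
  · exact ⟨_, Or.inl rfl, inner i hi h1.1 h1.2⟩
  by_cases h2 : 0 < j ∧ j + 1 < l.length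
  · exact ⟨_, Or.inr (Or.inl rfl), inner j hj h2.1 h2.2⟩
  · exact ⟨_, Or.inr (Or.inr rfl), inner k hk (by omega) (by omega)⟩

lemma IsFlatPath.exists_adj_mem {l : List V} (hl : IsFlatPath G l) {x y : V}
    (hx : x ∈ l) (hy : y ∈ l) (hxy : x ≠ y) : ∃ t ∈ l, G.Adj x t := by
  obtain ⟨i, hi, rfl⟩ := List.getElem_of_mem hx
  obtain ⟨j, hj, rfl⟩ := List.getElem_of_mem hy
  have hij : i ≠ j := fun h => hxy (by simp [h])
  by_cases h : i + 1 < l.length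
  · exact ⟨l[i + 1], List.getElem_mem _, (hl.1.2.2 i (i + 1) hi h).2 (Or.inl rfl)⟩
  · exact ⟨l[i - 1], List.getElem_mem _,
      (hl.1.2.2 i (i - 1) hi (by omega)).2 (Or.inr (by omega))⟩

lemma extendsToCover_of_coloring {P : Set V} {D : Bool → Set V}
    (hinter : D true ∩ D false = P) (hunion : D true ∪ D false = ClosedNbhd G P)
    (χ : V → Bool)
    (h : ∀ a, ChordalSet G (D a ∪ {z | z ∉ ClosedNbhd G P ∧ χ z = a})) :
    ExtendsToCover G P (D true) (D false) := by
  refine ⟨_, _, Set.subset_union_left, Set.subset_union_left, h true, h false, ?_, ?_⟩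
  · rw [← hunion, ← hinter]
    ext z
    cases h : χ z <;> simp [h] <;> tauto
  · rw [← hunion]
    ext z
    cases h : χ z <;> simp [h] <;> tauto

end

section

open SimpleGraph

variable {W : Type u} {T : SimpleGraph W} {c : W → Bool}

/-- An edge meeting the lower end of `e` whose own lower end is not deeper is `e` itself. -/
lemma edge_eq_of_mem_lower (hT : T.IsTree) {r : W} {e f : T.edgeSet} {p v q u : W}
    (hp : p ∈ e.1) (hv : v ∈ e.1) (hpv : p ≠ v) (hd : T.dist r v = T.dist r p + 1)
    (hq : q ∈ f.1) (hu : u ∈ f.1) (hqu : q ≠ u) (hd' : T.dist r u = T.dist r q + 1)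
    (hle : T.dist r u ≤ T.dist r v) (hvf : v ∈ f.1) : f = e := by
  rcases end_eq_or_eq hq hu hqu hvf with rfl | rfl
  · omega
  · obtain rfl := parent_unique hT (adj_of_mem_edge hp hv hpv) (adj_of_mem_edge hq hu hqu) hd hd'
    exact edge_ext hpv hq hu hp hv

lemma mem_closedNbhd_of_common_end {S : Set (T.edgeSet ⊕ Bool)} {e s : T.edgeSet} {p : W}
    (hs : Sum.inl s ∈ S) (hpe : p ∈ e.1) (hps : p ∈ s.1) :
    Sum.inl e ∈ ClosedNbhd (BGraph T c) S := by
  by_cases h : e = s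
  · exact Or.inl (h ▸ hs)
  · exact Or.inr ⟨_, hs, bGraph_adj_edge_edge.2 ⟨h, p, hpe, hps⟩⟩

lemma apex_mem_closedNbhd {S : Set (T.edgeSet ⊕ Bool)} {i : Bool} (hi : Sum.inr i ∈ S)
    (k : Bool) : Sum.inr k ∈ ClosedNbhd (BGraph T c) S := by
  by_cases h : k = i
  · exact Or.inl (h ▸ hi)
  · exact Or.inr ⟨_, hi, bGraph_adj_apex_apex.2 h⟩

lemma SparseLeaves.ncard_leaves_le_one (hT : SparseLeaves T) {k : Bool}
    (hk : {z | (BGraph T c).Adj (Sum.inr k) z}.ncard = 2) :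
    {v | IsLeaf T v ∧ c v = k}.ncard ≤ 1 := by
  have hfin : {z | (BGraph T c).Adj (Sum.inr k) z}.Finite :=
    Set.finite_of_ncard_ne_zero (by rw [hk]; norm_num)
  have hmem : (Sum.inr (!k) : T.edgeSet ⊕ Bool) ∈ {z | (BGraph T c).Adj (Sum.inr k) z} :=
    (bGraph_adj_apex_apex (T := T) (c := c)).2 (by cases k <;> simp)
  have hcard := Set.ncard_sdiff_singleton_add_one hmem hfin
  have := Set.ncard_le_ncard_of_injOn (s := {v | IsLeaf T v ∧ c v = k})
    (t := {z | (BGraph T c).Adj (Sum.inr k) z} \ {Sum.inr (!k)})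
    (fun v => if h : IsLeaf T v then Sum.inl (Classical.choose h.exists_edge) else Sum.inr k)
    (fun v hv => by
      simp only [hv.1, dif_pos]
      exact ⟨(bGraph_adj_edge_apex.2
        ⟨v, hv.1, hv.2, Classical.choose_spec hv.1.exists_edge⟩).symm, by simp⟩)
    (fun u hu v hv h => by
      simp only [hu.1, hv.1, dif_pos, Sum.inl.injEq] at h
      exact hT.leaf_mem_unique hu.1 (Classical.choose_spec hu.1.exists_edge) hv.1
        (h ▸ Classical.choose_spec hv.1.exists_edge)) (hfin.subset Set.sdiff_subset)
  omega

/-- At most one edge of a flat path through an apex meets an edge outside the path. -/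
lemma SparseLeaves.exposed_edge_unique [Finite W] (hT : SparseLeaves T)
    (hleaves : 3 ≤ ({v | IsLeaf T v} : Set W).ncard) {l : List (T.edgeSet ⊕ Bool)}
    (hl : IsFlatPath (BGraph T c) l) {i : Bool} (hi : Sum.inr i ∈ l) {s t e f : T.edgeSet}
    {p q : W} (hs : Sum.inl s ∈ l) (ht : Sum.inl t ∈ l) (he : Sum.inl e ∉ l)
    (hf : Sum.inl f ∉ l) (hpe : p ∈ e.1) (hps : p ∈ s.1) (hqf : q ∈ f.1) (hqt : q ∈ t.1) :
    s = t := by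
  by_contra hst
  have key : ∀ k : Bool, Sum.inr k ∈ l → {z | (BGraph T c).Adj (Sum.inr k) z}.ncard = 2 ∧
      {z | (BGraph T c).Adj (Sum.inr k) z} ⊆ {v | v ∈ l} := by
    intro k hk
    obtain ⟨z, rfl | rfl | rfl, h2, hsub⟩ := hl.neighbors_subset_of_three hs ht hk
      (fun h => hst (Sum.inl.inj h)) (by simp) (by simp)
    · exact absurd (hsub ((bGraph_adj_edge_edge (c := c)).2
        ⟨by rintro rfl; exact he hs, p, hps, hpe⟩)) he
    · exact absurd (hsub ((bGraph_adj_edge_edge (c := c)).2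
        ⟨by rintro rfl; exact hf ht, q, hqt, hqf⟩)) hf
    · exact ⟨h2, hsub⟩
  have hni : Sum.inr (!i) ∈ l :=
    (key i hi).2 ((bGraph_adj_apex_apex (T := T) (c := c)).2 (by cases i <;> simp))
  have h1 := hT.ncard_leaves_le_one (key i hi).1
  have h2 := hT.ncard_leaves_le_one (key _ hni).1
  have h3 : {v | IsLeaf T v} ⊆ {v | IsLeaf T v ∧ c v = i} ∪ {v | IsLeaf T v ∧ c v = !i} := by
    intro v hv
    by_cases h : c v = i
    · exact Or.inl ⟨hv, h⟩
    · exact Or.inr ⟨hv, Bool.eq_not_of_ne h⟩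
  have h4 := Set.ncard_le_ncard h3 (Set.toFinite _)
  have h5 := Set.ncard_union_le {v | IsLeaf T v ∧ c v = i} {v | IsLeaf T v ∧ c v = !i}
  omega

/-- The edges of a flat path through an apex meet the other edges only at a single vertex. -/
lemma SparseLeaves.exists_root [Finite W] (hT : SparseLeaves T)
    (hleaves : 3 ≤ ({v | IsLeaf T v} : Set W).ncard) {l : List (T.edgeSet ⊕ Bool)}
    (hl : IsFlatPath (BGraph T c) l) {i : Bool} (hi : Sum.inr i ∈ l) :
    ∃ r, ¬ IsLeaf T r ∧
      (∀ (e s : T.edgeSet) (p : W), Sum.inl e ∉ l → Sum.inl s ∈ l → p ∈ e.1 → p ∈ s.1 → p = r) ∧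
      (∀ s : T.edgeSet, Sum.inl s ∈ l → ∃ t : T.edgeSet, Sum.inl t ∈ l ∧ r ∈ t.1) := by
  have hend : ∀ e : T.edgeSet, ∃ r, r ∈ e.1 ∧ ¬ IsLeaf T r := by
    intro e
    obtain ⟨p, v, hp, hv, hne, -⟩ := exists_oriented_ends hT.isTree e.1.out.1 e
    by_cases h : IsLeaf T p
    · exact ⟨v, hv, hT.not_leaf_of_adj p v h (adj_of_mem_edge hp hv hne)⟩
    · exact ⟨p, hp, h⟩
  by_cases hex : ∃ (e s : T.edgeSet) (p : W),
      Sum.inl e ∉ l ∧ Sum.inl s ∈ l ∧ p ∈ e.1 ∧ p ∈ s.1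
  · obtain ⟨e, s, p, he, hs, hpe, hps⟩ := hex
    have hes : e ≠ s := fun h => he (h ▸ hs)
    refine ⟨p, fun hp => hes (hp.edge_unique hpe hps), ?_, fun _ _ => ⟨s, hs, hps⟩⟩
    intro f t q hf ht hqf hqt
    obtain rfl := hT.exposed_edge_unique hleaves hl hi hs ht he hf hpe hps hqf hqt
    by_contra hqp
    obtain ⟨z, hz, hadj⟩ := hl.exists_adj_mem hs hi (by simp)
    rcases z with g | k
    · obtain ⟨hsg, w, hws, hwg⟩ := bGraph_adj_edge_edge.1 hadj
      rcases end_eq_or_eq hqt hps hqp hws with rfl | rfl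
      · exact hsg (hT.exposed_edge_unique hleaves hl hi hs hz he hf hpe hps hqf hwg)
      · exact hsg (hT.exposed_edge_unique hleaves hl hi hs hz he he hpe hps hpe hwg)
    · obtain ⟨w, hw, -, hws⟩ := bGraph_adj_edge_apex.1 hadj
      rcases end_eq_or_eq hqt hps hqp hws with rfl | rfl
      · exact hf (hw.edge_unique hqf hqt ▸ hs)
      · exact hes (hw.edge_unique hpe hps)
  · have hno : ∀ r (e s : T.edgeSet) (p : W), Sum.inl e ∉ l → Sum.inl s ∈ l → p ∈ e.1 →
        p ∈ s.1 → p = r :=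
      fun _ e s p he hs hpe hps => absurd ⟨e, s, p, he, hs, hpe, hps⟩ hex
    by_cases hS : ∃ s : T.edgeSet, Sum.inl s ∈ l
    · obtain ⟨s, hs⟩ := hS
      obtain ⟨r, hrs, hr⟩ := hend s
      exact ⟨r, hr, hno r, fun _ _ => ⟨s, hs, hrs⟩⟩
    · obtain ⟨v, hv⟩ := Set.nonempty_of_ncard_ne_zero
        (s := {v | IsLeaf T v}) (by omega)
      obtain ⟨e, -⟩ := IsLeaf.exists_edge hv
      obtain ⟨r, -, hr⟩ := hend e
      exact ⟨r, hr, hno r, fun s hs => absurd ⟨s, hs⟩ hS⟩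

lemma SparseLeaves.extends_of_apex_mem [Finite W] (hT : SparseLeaves T)
    (hleaves : 3 ≤ ({v | IsLeaf T v} : Set W).ncard) {l : List (T.edgeSet ⊕ Bool)}
    (hl : IsFlatPath (BGraph T c) l) {i : Bool} (hi : Sum.inr i ∈ l)
    {D : Bool → Set (T.edgeSet ⊕ Bool)} (hD : ∀ a, ChordalSet (BGraph T c) (D a))
    (hinter : D true ∩ D false = {v | v ∈ l})
    (hunion : D true ∪ D false = ClosedNbhd (BGraph T c) {v | v ∈ l}) :
    ExtendsToCover (BGraph T c) {v | v ∈ l} (D true) (D false) := by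
  obtain ⟨r, hr, hroot, hrS⟩ := hT.exists_root hleaves hl hi
  have hsub : ∀ a z, z ∈ l → z ∈ D a := by
    intro a z hz
    have h : z ∈ D true ∩ D false := hinter ▸ hz
    cases a
    exacts [h.2, h.1]
  have hsplit : ∀ z, z ∉ l → ∃ b, z ∉ D b := by
    intro z hz
    by_contra! h
    have h' : z ∈ D true ∩ D false := ⟨h _, h _⟩
    rw [hinter] at h'
    exact hz h'
  have hapexN := apex_mem_closedNbhd (T := T) (c := c) (S := {v | v ∈ l}) hi
  have hcol : ∀ e : T.edgeSet, ∃ b : Bool, Sum.inl e ∉ ClosedNbhd (BGraph T c) {v | v ∈ l} →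
      (∀ v, IsLeaf T v → v ∈ e.1 → Sum.inr (c v) ∉ D b) ∧
      ((∀ v ∈ e.1, ¬ IsLeaf T v) → ∀ (q p v : W) (g : T.edgeSet), q ∈ e.1 → p ∈ e.1 → q ≠ p →
        T.dist r p = T.dist r q + 1 → IsLeaf T v → v ∈ g.1 → p ∈ g.1 → p ≠ v →
        Sum.inl g ∉ l → Sum.inl g ∉ D b) := by
    intro e
    by_cases heN : Sum.inl e ∈ ClosedNbhd (BGraph T c) {v | v ∈ l}
    · exact ⟨true, fun h => absurd heN h⟩
    by_cases hleaf : ∃ v, IsLeaf T v ∧ v ∈ e.1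
    · obtain ⟨v, hv, hve⟩ := hleaf
      have hx : Sum.inr (c v) ∉ l := fun h =>
        heN (Or.inr ⟨_, h, bGraph_adj_edge_apex.2 ⟨v, hv, rfl, hve⟩⟩)
      obtain ⟨b, hb⟩ := hsplit _ hx
      refine ⟨b, fun _ => ⟨fun u hu hue => ?_, fun h => absurd hv (h v hve)⟩⟩
      rwa [hT.leaf_mem_unique hu hue hv hve]
    · push Not at hleaf
      by_cases hex : ∃ (q p v : W) (g : T.edgeSet), q ∈ e.1 ∧ p ∈ e.1 ∧ q ≠ p ∧
        T.dist r p = T.dist r q + 1 ∧ IsLeaf T v ∧ v ∈ g.1 ∧ p ∈ g.1 ∧ p ≠ v ∧ Sum.inl g ∉ l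
      · obtain ⟨q, p, v, g, hq, hp, hqp, hd, hv, hvg, hpg, hpv, hg⟩ := hex
        obtain ⟨b, hb⟩ := hsplit _ hg
        refine ⟨b, fun _ => ⟨fun u hu hue => absurd hue (hleaf u hu), ?_⟩⟩
        intro _ q' p' v' g' hq' hp' hqp' hd' hv' hvg' hpg' hpv' _
        have hpp : p' = p := by
          rcases end_eq_or_eq hq hp hqp hp' with rfl | h
          · rcases end_eq_or_eq hq hp hqp hq' with rfl | rfl
            · exact absurd rfl hqp'
            · omega
          · exact h
        subst hpp
        rwa [(hT.leaf_edge_unique hpg' hpg hv' hvg' hpv' hv hvg hpv).2]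
      · refine ⟨true, fun _ => ⟨fun u hu hue => absurd hue (hleaf u hu), ?_⟩⟩
        intro _ q p v g hq hp hqp hd hv hvg hpg hpv hg
        exact absurd ⟨q, p, v, g, hq, hp, hqp, hd, hv, hvg, hpg, hpv, hg⟩ hex
  choose χ hχ using hcol
  refine extendsToCover_of_coloring hinter hunion (Sum.elim χ id) fun a H hHX hhole => ?_
  have hH := hhole.noSimplicial
  have hmemD : ∀ z ∈ H, z ∈ ClosedNbhd (BGraph T c) {v | v ∈ l} → z ∈ D a := fun z hz hzN =>
    (hHX hz).elim id fun h => absurd hzN h.1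
  have hnot : ¬ H ⊆ D a := fun h => hD a H h hhole
  obtain ⟨z, hzH, hzD⟩ := Set.not_subset.1 hnot
  rcases z with e₀ | k
  swap
  · exact hzD (hmemD _ hzH (hapexN k))
  choose up lo hup hlo hne hd using exists_oriented_ends hT.isTree r
  obtain ⟨m, ⟨hmH, hml⟩, hmax⟩ := Set.exists_max_image
    {e : T.edgeSet | Sum.inl e ∈ H ∧ Sum.inl e ∉ l} (fun e => T.dist r (lo e)) (Set.toFinite _)
    ⟨e₀, hzH, fun h => hzD (hsub a _ h)⟩
  have hupleaf : ∀ e, ¬ IsLeaf T (up e) := fun e =>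
    hT.not_leaf_of_child hr (adj_of_mem_edge (hup e) (hlo e) (hne e)) (hd e)
  have claim : ∀ e : T.edgeSet, Sum.inl e ∈ H → Sum.inl e ∉ l →
      T.dist r (lo e) = T.dist r (lo m) → IsLeaf T (lo e) ∧ Sum.inl e ∈ D a ∧
        ∃ f : T.edgeSet, Sum.inl f ∈ H ∧ f ≠ e ∧ up e ∈ f.1 := by
    intro e heH hel hde
    obtain ⟨u, hu, hue, hxu, hf⟩ := exists_apex_of_unique_at_end hH heH (hup e) (hlo e) (hne e)
      (fun f hf hvf => by
        by_cases hfl : Sum.inl f ∈ l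
        · have h1 := hroot e f _ hel hfl (hlo e) hvf
          have h2 := hd e
          rw [h1, dist_self] at h2
          omega
        · exact edge_eq_of_mem_lower hT.isTree (hup e) (hlo e) (hne e) (hd e) (hup f) (hlo f)
            (hne f) (hd f) (hde ▸ hmax f ⟨hf, hfl⟩) hvf)
    rcases end_eq_or_eq (hup e) (hlo e) (hne e) hue with rfl | rfl
    · exact absurd hu (hupleaf e)
    · refine ⟨hu, ?_, hf⟩
      rcases hHX heH with h | ⟨hN, rfl⟩
      · exact h
      · exact absurd (hmemD _ hxu (hapexN _)) ((hχ e hN).1 _ hu (hlo e))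
  obtain ⟨hleaf, hmD, f, hfH, hfm, hpf⟩ := claim m hmH hml rfl
  have hdm := hd m
  have hdf := hd f
  have hrr : T.dist r r = 0 := dist_self
  have hreduce : (∀ e : T.edgeSet, Sum.inl e ∈ H → Sum.inl e ∉ l →
      T.dist r (lo e) ≠ T.dist r (lo m) → Sum.inl e ∈ D a) → False := by
    intro h
    refine hnot fun z hz => ?_
    rcases z with e | k
    · by_cases hel : Sum.inl e ∈ l
      · exact hsub a _ hel
      · by_cases hde : T.dist r (lo e) = T.dist r (lo m)
        · exact (claim e hz hel hde).2.1
        · exact h e hz hel hde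
    · exact hmemD _ hz (hapexN k)
  rcases end_eq_or_eq (hup f) (hlo f) (hne f) hpf with hp | hp
  · by_cases hfl : Sum.inl f ∈ l
    · have hpr := hroot m f _ hml hfl (hup m) hpf
      refine hreduce fun e heH hel hde => ?_
      have h1 := hmax e ⟨heH, hel⟩
      have h2 := hd e
      rw [hpr, hrr] at hdm
      omega
    · obtain ⟨hleaf', -⟩ := claim f hfH hfl (by rw [hdm, hdf, hp])
      exact hfm (hT.leaf_edge_unique hpf (hup m) hleaf' (hlo f) (hp ▸ hne f) hleaf (hlo m)
        (hne m)).2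
  · by_cases hfl : Sum.inl f ∈ l
    · have hpr := hroot m f _ hml hfl (hup m) hpf
      rw [← hp, hpr, hrr] at hdf
      omega
    have hnl : ∀ v ∈ f.1, ¬ IsLeaf T v := by
      intro v hv
      rcases end_eq_or_eq (hup f) (hlo f) (hne f) hv with rfl | rfl
      · exact hupleaf f
      · exact hp ▸ hupleaf m
    rcases hHX hfH with hfD | ⟨hfN, rfl⟩
    · have hfN : Sum.inl f ∈ ClosedNbhd (BGraph T c) {v | v ∈ l} := by
        rw [← hunion]
        cases a
        exacts [Or.inr hfD, Or.inl hfD]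
      have hupr : up f = r := by
        rcases hfN with h | ⟨s, hs, hadj⟩
        · exact absurd h hfl
        · rcases s with s | k
          · obtain ⟨-, w, hwf, hws⟩ := bGraph_adj_edge_edge.1 hadj
            have hwr := hroot f s w hfl hs hwf hws
            rcases end_eq_or_eq (hup f) (hlo f) (hne f) hwf with h | h
            · exact h ▸ hwr
            · rw [← h, hwr, hrr] at hdf
              omega
          · obtain ⟨w, hw, -, hwf⟩ := bGraph_adj_edge_apex.1 hadj
            exact absurd hw (hnl w hwf)
      have hS : ∃ t : T.edgeSet, Sum.inl t ∈ l ∧ r ∈ t.1 := by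
        rcases hfN with h | ⟨s, hs, hadj⟩
        · exact absurd h hfl
        · rcases s with s | k
          · exact hrS s hs
          · obtain ⟨w, hw, -, hwf⟩ := bGraph_adj_edge_apex.1 hadj
            exact absurd hw (hnl w hwf)
      obtain ⟨t, ht, hrt⟩ := hS
      refine hreduce fun e heH hel hde => hmemD _ heH ?_
      have h1 := hmax e ⟨heH, hel⟩
      have h2 := hd e
      rw [hupr, hrr] at hdf
      rw [hp, hdf] at hdm
      have h3 : T.dist r (up e) = 0 := by omega
      have h4 : r = up e := hT.isTree.connected.dist_eq_zero_iff.1 h3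
      exact mem_closedNbhd_of_common_end ht (hup e) (h4 ▸ hrt)
    · exact (hχ f hfN).2 hnl (up f) (lo f) (lo m) m (hup f) (hlo f) (hne f) hdf hleaf (hlo m)
        (hp ▸ hup m) (hp ▸ hne m) hml hmD

end

section

open SimpleGraph

/-- A vertex of a path is exposed if it has a neighbor outside the path. -/
def Exposed {V : Type u} (G : SimpleGraph V) (l : List V) (x : V) : Prop :=
  x ∈ l ∧ ∃ y, y ∉ l ∧ G.Adj x y

lemma IsFlatPath.exposed_eq {V : Type u} {G : SimpleGraph V} {l : List V}
    (hl : IsFlatPath G l) {x y z : V} (hx : Exposed G l x) (hy : Exposed G l y)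
    (hz : Exposed G l z) : x = y ∨ x = z ∨ y = z := by
  by_contra! h
  obtain ⟨t, ht, -, hsub⟩ := hl.neighbors_subset_of_three hx.1 hy.1 hz.1 h.1 h.2.1 h.2.2
  have hexp : Exposed G l t := by
    rcases ht with rfl | rfl | rfl <;> assumption
  obtain ⟨u, hu, hadj⟩ := hexp.2
  exact hu (hsub hadj)

variable {W : Type u} {T : SimpleGraph W} {c : W → Bool}

/-- The neighbor `p` of the leaf `v` is an end of the exposed path vertex `s`. -/
structure LeafContact (T : SimpleGraph W) (c : W → Bool) (l : List (T.edgeSet ⊕ Bool))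
    (v p : W) (s : T.edgeSet) : Prop where
  leaf : IsLeaf T v
  adj : T.Adj p v
  mem : p ∈ s.1
  exposed : Exposed (BGraph T c) l (Sum.inl s)

lemma exposed_leaf_edge {l : List (T.edgeSet ⊕ Bool)} (hno : ∀ i, Sum.inr i ∉ l) {v : W}
    (hv : IsLeaf T v) {e : T.edgeSet} (hve : v ∈ e.1) (he : Sum.inl e ∈ l) :
    Exposed (BGraph T c) l (Sum.inl e) :=
  ⟨he, _, hno (c v), bGraph_adj_edge_apex.2 ⟨v, hv, rfl, hve⟩⟩

lemma exists_leafContact {l : List (T.edgeSet ⊕ Bool)} (hno : ∀ i, Sum.inr i ∉ l) {v : W}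
    (hv : IsLeaf T v) {e : T.edgeSet} (hve : v ∈ e.1)
    (he : Sum.inl e ∈ ClosedNbhd (BGraph T c) {v | v ∈ l}) :
    ∃ p s, LeafContact T c l v p s := by
  obtain ⟨p, hp, hne, hadj⟩ := exists_other_end e hve
  by_cases hel : Sum.inl e ∈ l
  · exact ⟨p, e, hv, hadj.symm, hp, exposed_leaf_edge hno hv hve hel⟩
  · rcases he with h | ⟨z, hz, hez⟩
    · exact absurd h hel
    rcases z with s | i
    · obtain ⟨hes, w, hwe, hws⟩ := bGraph_adj_edge_edge.1 hez
      rcases end_eq_or_eq hve hp hne hwe with rfl | rfl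
      · exact absurd (hv.edge_unique hwe hws) hes
      · exact ⟨w, s, hv, hadj.symm, hws, hz, _, hel, hez.symm⟩
    · exact absurd hz (hno i)

lemma SparseLeaves.not_exposed_of_contacts (hT : SparseLeaves T)
    {l : List (T.edgeSet ⊕ Bool)} (hl : IsFlatPath (BGraph T c) l) (hno : ∀ i, Sum.inr i ∉ l)
    {v w p q : W} {s t : T.edgeSet} (hv : LeafContact T c l v p s)
    (hw : LeafContact T c l w q s) (hvw : v ≠ w) (hp : p ∉ t.1) (hq : q ∉ t.1) :
    ¬ Exposed (BGraph T c) l (Sum.inl t) := by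
  intro ht
  have hpq : p ≠ q := by
    rintro rfl
    exact hvw (hT.twin_eq _ _ _ hv.leaf hw.leaf hv.adj hw.adj)
  have hst : s ≠ t := fun h => hp (h ▸ hv.mem)
  have hs : ∀ x ∈ s.1, ¬ IsLeaf T x := by
    intro x hx
    rcases end_eq_or_eq hv.mem hw.mem hpq hx with rfl | rfl
    · exact hT.not_leaf_of_adj _ _ hv.leaf hv.adj.symm
    · exact hT.not_leaf_of_adj _ _ hw.leaf hw.adj.symm
  obtain ⟨z, hz, hsz⟩ := hl.exists_adj_mem hv.exposed.1 ht.1 (by simpa using hst)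
  rcases z with u | i
  swap
  · exact hno i hz
  obtain ⟨hsu, x, hxs, hxu⟩ := bGraph_adj_edge_edge.1 hsz
  have key : ∀ v, LeafContact T c l v x s → x ∉ t.1 → False := by
    intro v hv hxt
    obtain ⟨g, hg, hgs, hxg⟩ : ∃ g : T.edgeSet, Exposed (BGraph T c) l (Sum.inl g) ∧
        g ≠ s ∧ x ∈ g.1 := by
      by_cases he : (Sum.inl ⟨s(x, v), hv.adj⟩ : T.edgeSet ⊕ Bool) ∈ l
      · refine ⟨_, exposed_leaf_edge hno hv.leaf (Sym2.mem_mk_right _ _) he, ?_,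
          Sym2.mem_mk_left _ _⟩
        intro h
        exact hs v (h ▸ Sym2.mem_mk_right _ _) hv.leaf
      · exact ⟨u, ⟨hz, _, he, bGraph_adj_edge_edge.2
          ⟨by rintro rfl; exact he hz, x, hxu, Sym2.mem_mk_left _ _⟩⟩, hsu.symm, hxu⟩
    rcases hl.exposed_eq hv.exposed hg ht with h | h | h
    · exact hgs (Sum.inl.inj h).symm
    · exact hst (Sum.inl.inj h)
    · exact hxt (Sum.inl.inj h ▸ hxg)
  rcases end_eq_or_eq hv.mem hw.mem hpq hxs with rfl | rfl
  · exact key v hv hp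
  · exact key w hw hq

/-- If a leaf edge lies on the path, then at most one leaf of the other color has its edge
near the path. -/
lemma SparseLeaves.leaf_unique_of_leaf_edge_mem (hT : SparseLeaves T)
    {l : List (T.edgeSet ⊕ Bool)} (hl : IsFlatPath (BGraph T c) l) (hno : ∀ i, Sum.inr i ∉ l)
    {x v w : W} {e f g : T.edgeSet} (hx : IsLeaf T x) (hxg : x ∈ g.1) (hg : Sum.inl g ∈ l)
    (hv : IsLeaf T v) (hve : v ∈ e.1) (hw : IsLeaf T w) (hwf : w ∈ f.1)
    (he : Sum.inl e ∈ ClosedNbhd (BGraph T c) {v | v ∈ l})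
    (hf : Sum.inl f ∈ ClosedNbhd (BGraph T c) {v | v ∈ l}) (hvx : v ≠ x) (hwx : w ≠ x) :
    v = w := by
  by_contra hvw
  obtain ⟨p, s, hps⟩ := exists_leafContact hno hv hve he
  obtain ⟨q, t, hqt⟩ := exists_leafContact hno hw hwf hf
  have hgexp := exposed_leaf_edge (c := c) hno hx hxg hg
  have key : ∀ {v p s}, LeafContact T c l v p s → v ≠ x → p ∉ g.1 := by
    intro v p s h hvx hpg
    have hpx : p ≠ x := by
      rintro rfl
      exact hT.not_leaf_of_adj _ _ h.leaf h.adj.symm hx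
    exact hvx (hT.twin_eq _ _ _ h.leaf hx h.adj (adj_of_mem_edge hpg hxg hpx))
  have hpg := key hps hvx
  have hqg := key hqt hwx
  rcases hl.exposed_eq hps.exposed hqt.exposed hgexp with h | h | h
  · obtain rfl := Sum.inl.inj h
    exact hT.not_exposed_of_contacts hl hno hps hqt hvw hpg hqg hgexp
  · exact hpg (Sum.inl.inj h ▸ hps.mem)
  · exact hqg (Sum.inl.inj h ▸ hqt.mem)

lemma SparseLeaves.contact_edge_ne (hT : SparseLeaves T) {l : List (T.edgeSet ⊕ Bool)}
    (hl : IsFlatPath (BGraph T c) l) (hno : ∀ i, Sum.inr i ∉ l) {v₁ v₂ v₃ v₄ p₁ p₂ p₃ p₄ : W}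
    {s₁ s₂ s₃ s₄ : T.edgeSet} (h₁ : LeafContact T c l v₁ p₁ s₁)
    (h₂ : LeafContact T c l v₂ p₂ s₂) (h₃ : LeafContact T c l v₃ p₃ s₃)
    (h₄ : LeafContact T c l v₄ p₄ s₄) (h₁₂ : v₁ ≠ v₂) (h₁₃ : v₁ ≠ v₃) (h₁₄ : v₁ ≠ v₄)
    (h₂₃ : v₂ ≠ v₃) (h₂₄ : v₂ ≠ v₄) (h₃₄ : v₃ ≠ v₄) : s₁ ≠ s₂ := by
  rintro rfl
  have hne : ∀ {v w p q s t}, LeafContact T c l v p s → LeafContact T c l w q t → v ≠ w →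
      p ≠ q := by
    rintro v w p _ s t hv hw hvw rfl
    exact hvw (hT.twin_eq _ _ _ hv.leaf hw.leaf hv.adj hw.adj)
  have hmem : ∀ {v p s}, LeafContact T c l v p s → v₁ ≠ v → v₂ ≠ v → s₁ ≠ s := by
    rintro v p _ hv h1 h2 rfl
    rcases end_eq_or_eq h₁.mem h₂.mem (hne h₁ h₂ h₁₂) hv.mem with h | h
    · exact hne h₁ hv h1 h.symm
    · exact hne h₂ hv h2 h.symm
  rcases hl.exposed_eq h₁.exposed h₃.exposed h₄.exposed with h | h | h
  · exact hmem h₃ h₁₃ h₂₃ (Sum.inl.inj h)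
  · exact hmem h₄ h₁₄ h₂₄ (Sum.inl.inj h)
  · obtain rfl := Sum.inl.inj h
    have hnot : ∀ {v p s}, LeafContact T c l v p s → v ≠ v₃ → v ≠ v₄ → p ∉ s₃.1 := by
      intro v p s hv h3 h4 hp
      rcases end_eq_or_eq h₃.mem h₄.mem (hne h₃ h₄ h₃₄) hp with h | h
      · exact hne hv h₃ h3 h
      · exact hne hv h₄ h4 h
    exact hT.not_exposed_of_contacts hl hno h₁ h₂ h₁₂ (hnot h₁ h₁₃ h₁₄) (hnot h₂ h₂₃ h₂₄)
      h₃.exposed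

lemma SparseLeaves.no_four_contacts (hT : SparseLeaves T) {l : List (T.edgeSet ⊕ Bool)}
    (hl : IsFlatPath (BGraph T c) l) (hno : ∀ i, Sum.inr i ∉ l) {v₁ v₂ v₃ v₄ p₁ p₂ p₃ p₄ : W}
    {s₁ s₂ s₃ s₄ : T.edgeSet} (h₁ : LeafContact T c l v₁ p₁ s₁)
    (h₂ : LeafContact T c l v₂ p₂ s₂) (h₃ : LeafContact T c l v₃ p₃ s₃)
    (h₄ : LeafContact T c l v₄ p₄ s₄) (h₁₂ : v₁ ≠ v₂) (h₁₃ : v₁ ≠ v₃) (h₁₄ : v₁ ≠ v₄)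
    (h₂₃ : v₂ ≠ v₃) (h₂₄ : v₂ ≠ v₄) (h₃₄ : v₃ ≠ v₄) : False := by
  rcases hl.exposed_eq h₁.exposed h₂.exposed h₃.exposed with h | h | h
  · exact hT.contact_edge_ne hl hno h₁ h₂ h₃ h₄ h₁₂ h₁₃ h₁₄ h₂₃ h₂₄ h₃₄ (Sum.inl.inj h)
  · exact hT.contact_edge_ne hl hno h₁ h₃ h₂ h₄ h₁₃ h₁₂ h₁₄ h₂₃.symm h₃₄ h₂₄ (Sum.inl.inj h)
  · exact hT.contact_edge_ne hl hno h₂ h₃ h₁ h₄ h₂₃ h₁₂.symm h₂₄ h₁₃.symm h₃₄ h₁₄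
      (Sum.inl.inj h)

lemma SparseLeaves.extends_of_no_leaf_edge_mem [Finite W] (hT : SparseLeaves T)
    {l : List (T.edgeSet ⊕ Bool)} (hl : IsFlatPath (BGraph T c) l) (hno : ∀ i, Sum.inr i ∉ l)
    (hleaf : ∀ (v : W) (e : T.edgeSet), IsLeaf T v → v ∈ e.1 → Sum.inl e ∉ l)
    {D : Bool → Set (T.edgeSet ⊕ Bool)}
    (hinter : D true ∩ D false = {v | v ∈ l})
    (hunion : D true ∪ D false = ClosedNbhd (BGraph T c) {v | v ∈ l}) :
    ExtendsToCover (BGraph T c) {v | v ∈ l} (D true) (D false) := by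
  have hDN : ∀ a, D a ⊆ ClosedNbhd (BGraph T c) {v | v ∈ l} := by
    intro a
    rw [← hunion]
    cases a
    exacts [Set.subset_union_right, Set.subset_union_left]
  have hapex : ∀ i, Sum.inr i ∉ ClosedNbhd (BGraph T c) {v | v ∈ l} := by
    rintro i (h | ⟨s | k, hs, hadj⟩)
    · exact hno i h
    · obtain ⟨v, hv, -, hvs⟩ := bGraph_adj_edge_apex.1 hadj.symm
      exact hleaf v s hv hvs hs
    · exact hno k hs
  obtain ⟨a, ha⟩ : ∃ a, ∀ (u v : W) (e f : T.edgeSet), IsLeaf T u → IsLeaf T v → u ∈ e.1 →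
      v ∈ f.1 → Sum.inl e ∈ D a → Sum.inl f ∈ D a → u = v := by
    by_contra! h
    obtain ⟨v₁, v₂, e₁, e₂, hv₁, hv₂, he₁, he₂, hD₁, hD₂, h₁₂⟩ := h true
    obtain ⟨v₃, v₄, e₃, e₄, hv₃, hv₄, he₃, he₄, hD₃, hD₄, h₃₄⟩ := h false
    have hne : ∀ {u v e f}, IsLeaf T u → u ∈ e.1 → v ∈ f.1 → Sum.inl e ∈ D true →
        Sum.inl f ∈ D false → u ≠ v := by
      rintro u _ e f hu hue huf he hf rfl
      obtain rfl := hu.edge_unique hue huf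
      exact hleaf u e hu hue (hinter.subset ⟨he, hf⟩)
    obtain ⟨_, _, c₁⟩ := exists_leafContact hno hv₁ he₁ (hDN _ hD₁)
    obtain ⟨_, _, c₂⟩ := exists_leafContact hno hv₂ he₂ (hDN _ hD₂)
    obtain ⟨_, _, c₃⟩ := exists_leafContact hno hv₃ he₃ (hDN _ hD₃)
    obtain ⟨_, _, c₄⟩ := exists_leafContact hno hv₄ he₄ (hDN _ hD₄)
    exact hT.no_four_contacts hl hno c₁ c₂ c₃ c₄ h₁₂ (hne hv₁ he₁ he₃ hD₁ hD₃)
      (hne hv₁ he₁ he₄ hD₁ hD₄) (hne hv₂ he₂ he₃ hD₂ hD₃) (hne hv₂ he₂ he₄ hD₂ hD₄) h₃₄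
  refine extendsToCover_of_coloring hinter hunion (Sum.elim (fun _ => !a) fun _ => a)
    fun b H hHX hhole => ?_
  obtain ⟨u, v, huv, hu, hv, hxu, -, e, f, hue, hvf, he, hf⟩ :=
    hT.exists_two_leaf_edges hhole.noSimplicial
  obtain rfl : a = b := (hHX hxu).elim (fun h => absurd (hDN _ h) (hapex _)) fun h => h.2
  have hmem : ∀ g : T.edgeSet, Sum.inl g ∈ H → Sum.inl g ∈ D a := fun g hg =>
    (hHX hg).elim id fun h => absurd h.2 (by simp)
  exact huv (ha u v e f hu hv hue hvf (hmem e he) (hmem f hf))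

lemma SparseLeaves.extends_of_leaf_edge_mem [Finite W] (hT : SparseLeaves T)
    {l : List (T.edgeSet ⊕ Bool)} (hl : IsFlatPath (BGraph T c) l) (hno : ∀ i, Sum.inr i ∉ l)
    {x : W} {g : T.edgeSet} (hx : IsLeaf T x) (hxg : x ∈ g.1) (hg : Sum.inl g ∈ l)
    {D : Bool → Set (T.edgeSet ⊕ Bool)} (hD : ∀ a, ChordalSet (BGraph T c) (D a))
    (hinter : D true ∩ D false = {v | v ∈ l})
    (hunion : D true ∪ D false = ClosedNbhd (BGraph T c) {v | v ∈ l}) :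
    ExtendsToCover (BGraph T c) {v | v ∈ l} (D true) (D false) := by
  have hDN : ∀ a, D a ⊆ ClosedNbhd (BGraph T c) {v | v ∈ l} := by
    intro a
    rw [← hunion]
    cases a
    exacts [Set.subset_union_right, Set.subset_union_left]
  have hxN : Sum.inr (c x) ∈ ClosedNbhd (BGraph T c) {v | v ∈ l} :=
    Or.inr ⟨_, hg, (bGraph_adj_edge_apex.2 ⟨x, hx, rfl, hxg⟩).symm⟩
  obtain ⟨a, ha⟩ : ∃ a, Sum.inr (c x) ∈ D a := by
    rw [← hunion] at hxN
    exact hxN.elim (fun h => ⟨_, h⟩) fun h => ⟨_, h⟩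
  have hdisj : ∀ i, Sum.inr i ∈ D a → Sum.inr i ∉ D (!a) := by
    intro i h h'
    refine hno i (hinter.subset ?_)
    cases a
    exacts [⟨h', h⟩, ⟨h, h'⟩]
  by_cases hj : Sum.inr (!c x) ∈ D a
  · refine extendsToCover_of_coloring hinter hunion (fun _ => !a) fun b H hHX hhole => ?_
    by_cases hb : b = a
    · subst hb
      exact hD b H (fun z hz => (hHX hz).elim id fun h => absurd h.2 (by simp)) hhole
    · obtain rfl := Bool.eq_not_of_ne hb
      obtain ⟨u, -, -, -, -, hxu, -⟩ := hT.exists_two_leaf_edges hhole.noSimplicial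
      have hmem : Sum.inr (c u) ∈ D a := by
        by_cases hcu : c u = c x
        · rwa [hcu]
        · rwa [Bool.eq_not_of_ne hcu]
      exact (hHX hxu).elim (hdisj _ hmem) fun h => h.1 (hDN _ hmem)
  · refine extendsToCover_of_coloring hinter hunion
      (Sum.elim (fun e => if ∃ v, IsLeaf T v ∧ c v ≠ c x ∧ v ∈ e.1 then a else !a)
        fun _ => !a) fun b H hHX hhole => ?_
    by_cases hb : b = a
    · subst hb
      refine hD b H (fun z hz => (hHX hz).elim id fun ⟨hzN, hzc⟩ => ?_) hhole
      rcases z with e | i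
      · by_cases h : ∃ v, IsLeaf T v ∧ c v ≠ c x ∧ v ∈ e.1
        · obtain ⟨v, hv, hcv, hve⟩ := h
          have h1 := hT.apex_mem_of_leaf_edge_mem hhole.noSimplicial hz hv hve
          rw [Bool.eq_not_of_ne hcv] at h1
          exact (hHX h1).elim (fun h => absurd h hj) fun h => absurd h.2 (by simp)
        · simp [h] at hzc
      · simp at hzc
    · obtain rfl := Bool.eq_not_of_ne hb
      obtain ⟨u, v, huv, hu, hv, hxu, hxv, e, f, hue, hvf, he, hf⟩ :=
        hT.exists_two_leaf_edges hhole.noSimplicial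
      have hcol : ∀ w, Sum.inr (c w) ∈ H → c w ≠ c x := by
        intro w hw hcw
        rw [hcw] at hw
        exact (hHX hw).elim (hdisj _ ha) fun h => h.1 hxN
      have hmem : ∀ (w : W) (h : T.edgeSet), IsLeaf T w → w ∈ h.1 → c w ≠ c x →
          Sum.inl h ∈ H → Sum.inl h ∈ ClosedNbhd (BGraph T c) {v | v ∈ l} := by
        intro w h hw hwh hcw hh
        refine (hHX hh).elim (fun h => hDN _ h) fun h' => absurd h'.2 ?_
        rw [Sum.elim_inl, if_pos ⟨w, hw, hcw, hwh⟩]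
        simp
      exact huv (hT.leaf_unique_of_leaf_edge_mem hl hno hx hxg hg hu hue hv hvf
        (hmem u e hu hue (hcol u hxu) he) (hmem v f hv hvf (hcol v hxv) hf)
        (fun h => hcol u hxu (h ▸ rfl)) fun h => hcol v hxv (h ▸ rfl))

end

/-- An extended nontrivial basic graph `B(T)` with no star cutset is not MNFPE. -/
theorem stmt5 {W : Type u} [Finite W] (T : SimpleGraph W) (hT : T.IsTree)
    (c : W → Bool) (hc : ∀ u v : W, T.Adj u v → c u ≠ c v)
    (hleaves : 3 ≤ ({v | IsLeaf T v} : Set W).ncard)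
    (hnonleaves : 2 ≤ ({v | ¬ IsLeaf T v} : Set W).ncard)
    (hSC : ¬ HasStarCutset (BGraph T c)) :
    ¬ MNFPE (BGraph T c) := by
  rintro ⟨hG, -⟩
  refine hG fun l hl W1 W2 hW1 hW2 hinter hunion => ?_
  have hS := sparseLeaves_of_no_starCutset hT hc hleaves hSC
  have hD : ∀ a, ChordalSet (BGraph T c) (cond a W1 W2) := by
    rintro (_ | _)
    exacts [hW2, hW1]
  by_cases hapex : ∃ i, Sum.inr i ∈ l
  · obtain ⟨i, hi⟩ := hapex
    exact hS.extends_of_apex_mem hleaves hl hi (D := fun a => cond a W1 W2) hD hinter hunion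
  push Not at hapex
  by_cases hleaf : ∃ (v : W) (e : T.edgeSet), IsLeaf T v ∧ v ∈ e.1 ∧ Sum.inl e ∈ l
  · obtain ⟨v, e, hv, hve, he⟩ := hleaf
    exact hS.extends_of_leaf_edge_mem hl hapex hv hve he (D := fun a => cond a W1 W2) hD
      hinter hunion
  · push Not at hleaf
    exact hS.extends_of_no_leaf_edge_mem hl hapex hleaf (D := fun a => cond a W1 W2) hinter
      hunion
end
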